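/- arXiv:1912.03532 — 3 statements merged into one kernel-verified Lean document; each statement's English description precedes it below -/
import Mathlib

section
/- Let Ω be an open set of finite Lebesgue measure in ℝⁿ, n ≥ 2, let m ∈ ℕ with m < n, and let d ∈ (0, n−m). Let ‖·‖_X and ‖·‖_Y be rearrangement-invariant function norms on (0,1). Let x₀ ∈ Ω, let g : (0,∞) → [0,∞) be a non-increasing measurable function, and let μ be the measure on Ω given by dμ(x) = g(|x−x₀|) dx; assume μ is finite and satisfies sup_{x ∈ ℝⁿ, r > 0} μ(B_r(x) ∩ Ω)/r^d < ∞. Assume there is a constant C₁ such that ‖ t ↦ ∫_{t^{n/d}}^1 f(s) s^{−1+m/n} ds ‖_Y ≤ C₁ ‖f‖_X for every nonnegative non-increasing measurable f on (0,1). Then there exists a constant C₂ such that for every u ∈ C_c^∞(Ω): ‖ t ↦ u*_μ(μ(Ω)·t) ‖_Y ≤ C₂ ‖ t ↦ (|∇^m u|)*(|Ω|·t) ‖_X. (Thus, for d-Frostman measures with a radially decreasing density, the same single Hardy-type inequality as in the regime d ∈ [n−m, n] suffices.) -/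
open MeasureTheory Set
open scoped ENNReal NNReal

/-- Lebesgue measure on the interval `(0,1)`. -/
noncomputable def vol01 : MeasureTheory.Measure ℝ :=
  MeasureTheory.volume.restrict (Set.Ioo 0 1)

/-- The non-increasing rearrangement on `(0,1)` of an extended-nonnegative function. -/
noncomputable def decRearr (f : ℝ → ℝ≥0∞) (s : ℝ) : ℝ≥0∞ :=
  sInf {ρ : ℝ≥0∞ | vol01 {t | ρ < f t} ≤ ENNReal.ofReal s}

/-- The non-increasing rearrangement of a real-valued function with respect to a measure. -/
noncomputable def rearr {α : Type*} [MeasurableSpace α] (ν : MeasureTheory.Measure α)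
    (u : α → ℝ) (s : ℝ) : ℝ≥0∞ :=
  sInf {ρ : ℝ≥0∞ | ν {x | ρ < ENNReal.ofReal |u x|} ≤ ENNReal.ofReal s}

/-- A rearrangement-invariant function norm on `(0,1)`: properties (P1)–(P6). -/
structure IsRINorm (N : (ℝ → ℝ≥0∞) → ℝ≥0∞) : Prop where
  eq_zero_iff : ∀ f : ℝ → ℝ≥0∞, N f = 0 ↔ (∀ᵐ t ∂vol01, f t = 0)
  smul : ∀ (c : ℝ≥0) (f : ℝ → ℝ≥0∞), N (fun t => (c : ℝ≥0∞) * f t) = (c : ℝ≥0∞) * N f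
  add_le : ∀ f g : ℝ → ℝ≥0∞, N (fun t => f t + g t) ≤ N f + N g
  mono : ∀ f g : ℝ → ℝ≥0∞, (∀ᵐ t ∂vol01, f t ≤ g t) → N f ≤ N g
  iSup_eq : ∀ (f : ℕ → ℝ → ℝ≥0∞) (g : ℝ → ℝ≥0∞),
    (∀ k, ∀ᵐ t ∂vol01, f k t ≤ f (k + 1) t) →
    (∀ᵐ t ∂vol01, (⨆ k, f k t) = g t) → N g = ⨆ k, N (f k)
  indicator_lt_top : ∀ E : Set ℝ, MeasurableSet E → E ⊆ Set.Ioo 0 1 → N (E.indicator 1) < ⊤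
  exists_integral_le : ∀ E : Set ℝ, MeasurableSet E → E ⊆ Set.Ioo 0 1 →
    ∃ C : ℝ≥0, ∀ f : ℝ → ℝ≥0∞, (∫⁻ t in E, f t) ≤ (C : ℝ≥0∞) * N f
  rearr_invariant : ∀ f g : ℝ → ℝ≥0∞, decRearr f = decRearr g → N f = N g

/-- The Hardy-type operator `S₁f(t) = ∫_{t^{n/d}}^1 f(s) s^{-1+m/n} ds`. -/
noncomputable def S1 (n m : ℕ) (d : ℝ) (f : ℝ → ℝ≥0∞) (t : ℝ) : ℝ≥0∞ :=
  ∫⁻ s in Set.Ioo (t ^ ((n : ℝ) / d)) 1, ENNReal.ofReal (s ^ ((m : ℝ) / n - 1)) * f s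

/-- The Hardy-type operator
`S₂f(t) = t^{-m/(n-d)} ∫_0^{t^{n/d}} f(s) s^{-1+m/(n-d)} ds`. -/
noncomputable def S2 (n m : ℕ) (d : ℝ) (f : ℝ → ℝ≥0∞) (t : ℝ) : ℝ≥0∞ :=
  ENNReal.ofReal (t ^ (-((m : ℝ) / ((n : ℝ) - d)))) *
    ∫⁻ s in Set.Ioo (0 : ℝ) (t ^ ((n : ℝ) / d)),
      ENNReal.ofReal (s ^ ((m : ℝ) / ((n : ℝ) - d) - 1)) * f s

/-- The non-increasing rearrangement of an extended-nonnegative function with respect to an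
arbitrary measure; both `decRearr` and `rearr` are instances of it. -/
noncomputable def distRearr {α : Type*} [MeasurableSpace α] (ν : Measure α)
    (f : α → ℝ≥0∞) (s : ℝ) : ℝ≥0∞ :=
  sInf {ρ : ℝ≥0∞ | ν {x | ρ < f x} ≤ ENNReal.ofReal s}

section Rearrangement

variable {α : Type*} [MeasurableSpace α]

lemma lt_distRearr_iff (ν : Measure α) (f : α → ℝ≥0∞) (s : ℝ) (ρ : ℝ≥0∞) :
    ρ < distRearr ν f s ↔ ENNReal.ofReal s < ν {x | ρ < f x} := by
  constructor
  · intro h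
    by_contra! hc
    exact absurd (sInf_le (show ρ ∈ {ρ : ℝ≥0∞ | ν {x | ρ < f x} ≤ ENNReal.ofReal s} from hc))
      (not_le.2 h)
  · contrapose!
    intro h
    rcases eq_or_ne ρ ⊤ with rfl | hρ
    · simp
    obtain ⟨r, hr, hrm, hrt⟩ := exists_seq_strictAnti_tendsto' (lt_top_iff_ne_top.2 hρ)
    have hU : {x | ρ < f x} = ⋃ k, {x | r k < f x} := by
      ext x
      simp only [mem_ofPred_eq, mem_iUnion]
      constructor
      · intro hx
        exact ((hrt.eventually (gt_mem_nhds hx))).exists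
      · rintro ⟨k, hk⟩
        exact (hrm k).1.trans hk
    have hmono : Monotone fun k => {x | r k < f x} := fun i j hij x hx =>
      (hr.antitone hij).trans_lt hx
    rw [hU, hmono.measure_iUnion]
    refine iSup_le fun k => ?_
    obtain ⟨ρ', hρ', hlt⟩ := sInf_lt_iff.1 (h.trans_lt (hrm k).1)
    exact (measure_mono fun x hx => hlt.trans hx).trans hρ'

lemma distRearr_antitone (ν : Measure α) (f : α → ℝ≥0∞) : Antitone (distRearr ν f) := by
  intro s t hst
  exact sInf_le_sInf fun ρ hρ => le_trans hρ (ENNReal.ofReal_le_ofReal hst)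

lemma vol01_apply (S : Set ℝ) : vol01 S = volume (S ∩ Ioo 0 1) :=
  Measure.restrict_apply' measurableSet_Ioo

lemma vol01_apply_Ioc (S : Set ℝ) : vol01 S = volume (S ∩ Ioc 0 1) := by
  rw [vol01, Measure.restrict_congr_set Ioo_ae_eq_Ioc, Measure.restrict_apply' measurableSet_Ioc]

lemma vol01_apply_Ico (S : Set ℝ) : vol01 S = volume (S ∩ Ico 0 1) := by
  rw [vol01, Measure.restrict_congr_set Ioo_ae_eq_Ico, Measure.restrict_apply' measurableSet_Ico]

instance : IsProbabilityMeasure vol01 :=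
  ⟨by rw [vol01_apply]; simp⟩

lemma vol01_Iio {τ : ℝ} (hτ : τ ≤ 1) : vol01 (Iio τ) = ENNReal.ofReal τ := by
  rw [vol01_apply]
  have : Iio τ ∩ Ioo 0 1 = Ioo 0 τ := by
    ext t; simp only [mem_inter_iff, mem_Iio, mem_Ioo]; constructor
    · rintro ⟨a, b, c⟩; exact ⟨b, a⟩
    · rintro ⟨a, b⟩; exact ⟨b, a, b.trans_le hτ⟩
  rw [this]; simp

lemma vol01_ofReal_mul_lt {a : ℝ} (ha : 0 < a) (c : ℝ≥0∞) :
    vol01 {t | ENNReal.ofReal (a * t) < c} = min 1 (c / ENNReal.ofReal a) := by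
  rcases le_or_gt (ENNReal.ofReal a) c with h | h
  · have h1 : vol01 {t | ENNReal.ofReal (a * t) < c} = vol01 univ := by
      rw [vol01_apply, vol01_apply]
      congr 1
      ext t
      simp only [mem_inter_iff, mem_ofPred_eq, mem_Ioo, mem_univ, true_and, and_iff_right_iff_imp]
      rintro ⟨h0, h1⟩
      refine lt_of_lt_of_le ?_ h
      rw [ENNReal.ofReal_lt_ofReal_iff ha]
      nlinarith
    rw [h1, measure_univ, min_eq_left]
    rw [ENNReal.le_div_iff_mul_le (by simp [ha]) (by simp)]
    simpa using h
  · have hc : c ≠ ⊤ := ne_top_of_lt h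
    lift c to ℝ≥0 using hc
    have hca : (c : ℝ) < a := by
      rw [← ENNReal.ofReal_coe_nnreal, ENNReal.ofReal_lt_ofReal_iff ha] at h
      exact h
    have h1 : vol01 {t | ENNReal.ofReal (a * t) < c} = vol01 (Iio ((c : ℝ) / a)) := by
      rw [vol01_apply, vol01_apply]
      congr 1
      ext t
      simp only [mem_inter_iff, mem_ofPred_eq, mem_Ioo, mem_Iio, and_congr_left_iff]
      rintro ⟨h0, h1⟩
      rw [← ENNReal.ofReal_coe_nnreal, ENNReal.ofReal_lt_ofReal_iff_of_nonneg (by positivity),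
        lt_div_iff₀ ha, mul_comm]
    rw [h1, vol01_Iio ((div_le_one ha).2 hca.le), min_eq_right, ENNReal.ofReal_div_of_pos ha,
      ENNReal.ofReal_coe_nnreal]
    refine ENNReal.div_le_of_le_mul ?_
    simpa using h.le

lemma vol01_lt_distRearr {a : ℝ} (ha : 0 < a) (ν : Measure α) (f : α → ℝ≥0∞) (ρ : ℝ≥0∞) :
    vol01 {t | ρ < distRearr ν f (a * t)} = min 1 (ν {x | ρ < f x} / ENNReal.ofReal a) := by
  simp_rw [lt_distRearr_iff]
  exact vol01_ofReal_mul_lt ha _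

lemma vol01_lt_decRearr (f : ℝ → ℝ≥0∞) (ρ : ℝ≥0∞) :
    vol01 {t | ρ < decRearr f t} = vol01 {t | ρ < f t} := by
  have := vol01_lt_distRearr one_pos vol01 f ρ
  simp only [one_mul, ENNReal.ofReal_one, div_one] at this
  rw [min_eq_right prob_le_one] at this
  exact this

lemma decRearr_decRearr (f : ℝ → ℝ≥0∞) : decRearr (decRearr f) = decRearr f := by
  funext s
  rw [decRearr]
  simp_rw [vol01_lt_decRearr]
  rfl

end Rearrangement

namespace IsRINorm

variable {N : (ℝ → ℝ≥0∞) → ℝ≥0∞}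

lemma apply_decRearr (hN : IsRINorm N) (f : ℝ → ℝ≥0∞) : N (decRearr f) = N f :=
  hN.rearr_invariant _ _ (decRearr_decRearr f)

lemma le_of_dist_le (hN : IsRINorm N) {f g : ℝ → ℝ≥0∞}
    (h : ∀ ρ, vol01 {t | ρ < f t} ≤ vol01 {t | ρ < g t}) : N f ≤ N g := by
  rw [← hN.apply_decRearr f, ← hN.apply_decRearr g]
  refine hN.mono _ _ (Filter.Eventually.of_forall fun t => ?_)
  exact sInf_le_sInf fun ρ hρ => (h ρ).trans hρ

lemma sum_le (hN : IsRINorm N) {ι : Type*} (s : Finset ι) (f : ι → ℝ → ℝ≥0∞) :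
    N (fun t => ∑ i ∈ s, f i t) ≤ ∑ i ∈ s, N (f i) := by
  classical
  induction s using Finset.induction_on with
  | empty => simpa using (hN.eq_zero_iff _).2 (Filter.Eventually.of_forall fun t => rfl)
  | insert a s ha ih =>
    simp_rw [Finset.sum_insert ha]
    exact (hN.add_le _ _).trans (by gcongr)

end IsRINorm

/-- Index of the dyadic interval `(2^{-k-1}, 2^{-k}]` containing `t`. -/
noncomputable def dyadicIndex (t : ℝ) : ℕ := ⌊-Real.logb 2 t⌋₊

/-- Relative position of `t` in its dyadic interval. -/
noncomputable def dyadicPos (t : ℝ) : ℝ := 2 ^ (dyadicIndex t + 1) * t - 1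

lemma dyadicIndex_eq_iff {t : ℝ} (ht : t ∈ Ioo (0 : ℝ) 1) (k : ℕ) :
    dyadicIndex t = k ↔ (2⁻¹ : ℝ) ^ (k + 1) < t ∧ t ≤ 2⁻¹ ^ k := by
  have hl : 0 ≤ -Real.logb 2 t := by
    have := Real.logb_nonpos one_lt_two ht.1.le ht.2.le
    linarith
  rw [dyadicIndex, Nat.floor_eq_iff hl]
  have h1 : ((k : ℝ) ≤ -Real.logb 2 t) ↔ t ≤ 2⁻¹ ^ k := by
    rw [le_neg, Real.logb_le_iff_le_rpow one_lt_two ht.1, Real.rpow_neg (by norm_num),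
      Real.rpow_natCast, inv_pow]
  have h2 : (-Real.logb 2 t < (k : ℝ) + 1) ↔ (2⁻¹ : ℝ) ^ (k + 1) < t := by
    rw [neg_lt, Real.lt_logb_iff_rpow_lt one_lt_two ht.1, Real.rpow_neg (by norm_num), inv_pow]
    norm_cast
  rw [h1, h2, and_comm]

lemma dyadicPos_mem {t : ℝ} (ht : t ∈ Ioo (0 : ℝ) 1) : dyadicPos t ∈ Ioc (0 : ℝ) 1 := by
  obtain ⟨h1, h2⟩ := (dyadicIndex_eq_iff ht _).1 rfl
  rw [inv_pow, inv_lt_iff_one_lt_mul₀ (by positivity)] at h1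
  rw [inv_pow, le_inv_comm₀ ht.1 (by positivity), ← one_div, le_div_iff₀ ht.1] at h2
  simp only [dyadicPos, mem_Ioc]
  rw [pow_succ] at *
  constructor <;> nlinarith

lemma vol01_dyadic_le (Q : ℕ → ℝ → Prop) :
    vol01 {t | Q (dyadicIndex t) (dyadicPos t)} ≤
      ∑' k, (2⁻¹ : ℝ≥0∞) ^ (k + 1) * vol01 {θ | Q k θ} := by
  have hsub : {t | Q (dyadicIndex t) (dyadicPos t)} ∩ Ioo 0 1 ⊆
      ⋃ k : ℕ, (fun t : ℝ => 2 ^ (k + 1) * t) ⁻¹'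
        ((fun t : ℝ => t + (-1)) ⁻¹' ({θ | Q k θ} ∩ Ioc 0 1)) := by
    rintro t ⟨hQ, ht⟩
    refine mem_iUnion.2 ⟨dyadicIndex t, ?_⟩
    simp only [mem_preimage, ← sub_eq_add_neg]
    exact ⟨hQ, dyadicPos_mem ht⟩
  rw [vol01_apply]
  refine (measure_mono hsub).trans ((measure_iUnion_le _).trans (ENNReal.tsum_le_tsum fun k => ?_))
  have h2 : (0 : ℝ) < 2 ^ (k + 1) := pow_pos two_pos _
  have h3 : ENNReal.ofReal |((2 : ℝ) ^ (k + 1))⁻¹| = (2⁻¹ : ℝ≥0∞) ^ (k + 1) := by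
    rw [abs_of_pos (inv_pos.2 h2), ENNReal.ofReal_inv_of_pos h2,
      ENNReal.ofReal_pow zero_le_two, ENNReal.inv_pow, ENNReal.ofReal_ofNat]
  rw [Real.volume_preimage_mul_left h2.ne', h3, vol01_apply_Ioc]
  exact mul_le_mul_right (measure_preimage_add_right (volume : Measure ℝ) _ _).le _

lemma tsum_inv_two_pow_ge (k : ℕ) :
    ∑' j, (if k ≤ j then (2⁻¹ : ℝ≥0∞) ^ j else 0) = 2 * 2⁻¹ ^ k := by
  have h : (∑' j, (if k ≤ j then (2⁻¹ : ℝ≥0∞) ^ j else 0)) = ∑' i, (2⁻¹ : ℝ≥0∞) ^ (i + k) := by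
    rw [← Summable.sum_add_tsum_nat_add' (k := k) ENNReal.summable, Finset.sum_eq_zero, zero_add]
    · simp
    · intro i hi
      rw [Finset.mem_range] at hi
      simp [hi]
  rw [h]
  simp_rw [pow_add]
  rw [ENNReal.tsum_mul_right, ENNReal.tsum_geometric]
  simp

lemma exists_dyadic {τ : ℝ} (h0 : 0 < τ) (h1 : τ ≤ 1) :
    ∃ k : ℕ, (2⁻¹ : ℝ) ^ (k + 1) < τ ∧ τ ≤ 2⁻¹ ^ k :=
  exists_nat_pow_near_of_lt_one h0 h1 (by norm_num) (by norm_num)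

namespace IsRINorm

variable {N : (ℝ → ℝ≥0∞) → ℝ≥0∞}

/-- Boundedness of dilations, in terms of distribution functions. -/
lemma le_mul_of_dist_le_mul (hN : IsRINorm N) {f g : ℝ → ℝ≥0∞} (M : ℕ) (hM : M ≠ 0)
    (h : ∀ ρ, 2 * vol01 {t | ρ < g t} ≤ M * vol01 {t | ρ < f t}) : N g ≤ M * N f := by
  have hMpos : (0 : ℝ) < M := by positivity
  set A : ℕ → ℝ → Prop := fun i θ => (i : ℝ) < M * θ ∧ M * θ ≤ i + 1 with hA
  have hvolA : ∀ i, vol01 {θ | A i θ} ≤ (M : ℝ≥0∞)⁻¹ := by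
    intro i
    have : {θ | A i θ} ⊆ Ioc ((i : ℝ) / M) ((i + 1) / M) := by
      rintro θ ⟨h1, h2⟩
      exact ⟨by rw [div_lt_iff₀ hMpos]; linarith, by rw [le_div_iff₀ hMpos]; linarith⟩
    calc vol01 {θ | A i θ} ≤ volume {θ | A i θ} := Measure.restrict_apply_le _ _
      _ ≤ _ := measure_mono this
      _ = _ := by
        rw [Real.volume_Ioc, ← sub_div, add_sub_cancel_left, one_div,
          ENNReal.ofReal_inv_of_pos hMpos, ENNReal.ofReal_natCast]
  have hpiece : ∀ i, N (fun t => {t | A i (dyadicPos t)}.indicator (decRearr g) t) ≤ N f := by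
    intro i
    refine hN.le_of_dist_le fun ρ => ?_
    set τ := (vol01 {t | ρ < g t}) with hτ
    have hτ1 : τ ≤ 1 := prob_le_one
    rcases eq_or_ne τ 0 with h0 | h0
    · have : vol01 {t | ρ < decRearr g t} = 0 := by rw [vol01_lt_decRearr]; exact h0
      refine (measure_mono_null ?_ this).le.trans zero_le
      intro t ht
      exact lt_of_lt_of_le (mem_ofPred.1 ht) (indicator_le_self _ _ t)
    have hτt : τ ≠ ⊤ := ne_top_of_le_ne_top ENNReal.one_ne_top hτ1
    obtain ⟨k, hk1, hk2⟩ := exists_dyadic (ENNReal.toReal_pos h0 hτt)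
      (by simpa using ENNReal.toReal_mono ENNReal.one_ne_top hτ1)
    have hsub : vol01 {t | ρ < {t | A i (dyadicPos t)}.indicator (decRearr g) t} ≤
        vol01 {t | k ≤ dyadicIndex t ∧ A i (dyadicPos t)} := by
      rw [vol01_apply, vol01_apply]
      refine measure_mono ?_
      rintro t ⟨ht, ht01⟩
      refine ⟨?_, ht01⟩
      simp only [mem_ofPred_eq, indicator] at ht
      split_ifs at ht with hAt
      · refine ⟨?_, hAt⟩
        have h3 := (lt_distRearr_iff vol01 g t ρ).1 ht
        have h4 : t < τ.toReal := (ENNReal.ofReal_lt_iff_lt_toReal ht01.1.le hτt).1 h3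
        have h5 := ((dyadicIndex_eq_iff ht01 _).1 rfl).1
        have h6 := h5.trans (h4.trans_le hk2)
        have := (pow_lt_pow_iff_right_of_lt_one₀ (by norm_num) (by norm_num)).1 h6
        omega
      · simp at ht
    refine hsub.trans ((vol01_dyadic_le fun l θ => k ≤ l ∧ A i θ).trans ?_)
    calc ∑' l, (2⁻¹ : ℝ≥0∞) ^ (l + 1) * vol01 {θ | k ≤ l ∧ A i θ}
        ≤ ∑' l, (if k ≤ l then (2⁻¹ : ℝ≥0∞) ^ l else 0) * (2⁻¹ * (M : ℝ≥0∞)⁻¹) := by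
          refine ENNReal.tsum_le_tsum fun l => ?_
          split_ifs with hl
          · simp only [hl, true_and]
            rw [pow_succ, mul_assoc]
            gcongr
            exact hvolA i
          · simp [hl]
      _ = 2⁻¹ ^ k * (M : ℝ≥0∞)⁻¹ := by
          rw [ENNReal.tsum_mul_right, tsum_inv_two_pow_ge]
          rw [mul_comm 2, mul_assoc, ← mul_assoc 2, ENNReal.mul_inv_cancel (by simp) (by simp),
            one_mul]
      _ ≤ 2 * τ * (M : ℝ≥0∞)⁻¹ := by
          gcongr
          have : ENNReal.ofReal (2⁻¹ ^ k) ≤ ENNReal.ofReal (2 * τ.toReal) := by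
            apply ENNReal.ofReal_le_ofReal
            rw [pow_succ] at hk1
            linarith
          rw [ENNReal.ofReal_mul (by norm_num), ENNReal.ofReal_toReal hτt,
            ENNReal.ofReal_pow (by norm_num), ENNReal.ofReal_inv_of_pos (by norm_num)] at this
          simpa using this
      _ ≤ (M * vol01 {t | ρ < f t}) * (M : ℝ≥0∞)⁻¹ := mul_le_mul_left (h ρ) _
      _ = vol01 {t | ρ < f t} := by
          rw [mul_right_comm, ENNReal.mul_inv_cancel (by simpa using hM) (by simp), one_mul]
  rw [← hN.apply_decRearr g]
  calc N (decRearr g)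
      ≤ N (fun t => ∑ i ∈ Finset.range M, {t | A i (dyadicPos t)}.indicator (decRearr g) t) := by
        refine hN.mono _ _ ?_
        refine (ae_restrict_iff' measurableSet_Ioo).2 (Filter.Eventually.of_forall fun t ht => ?_)
        obtain ⟨hp0, hp1⟩ := dyadicPos_mem ht
        have hpos : 0 < M * dyadicPos t := by positivity
        have hc : 0 < ⌈M * dyadicPos t⌉₊ := Nat.ceil_pos.2 hpos
        have hi : ⌈M * dyadicPos t⌉₊ - 1 ∈ Finset.range M := by
          rw [Finset.mem_range]
          have : ⌈M * dyadicPos t⌉₊ ≤ M := by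
            rw [Nat.ceil_le]; nlinarith
          omega
        have hAi : A (⌈M * dyadicPos t⌉₊ - 1) (dyadicPos t) := by
          have h1 := Nat.ceil_lt_add_one hpos.le
          have h2 := Nat.le_ceil (M * dyadicPos t)
          simp only [hA, Nat.cast_sub (Nat.succ_le_of_lt hc)]
          push_cast
          constructor <;> linarith
        refine le_trans ?_ (Finset.single_le_sum (fun _ _ => zero_le) hi)
        rw [indicator_of_mem]
        exact hAi
    _ ≤ ∑ i ∈ Finset.range M, N (fun t => {t | A i (dyadicPos t)}.indicator (decRearr g) t) :=
        hN.sum_le _ _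
    _ ≤ ∑ i ∈ Finset.range M, N f := Finset.sum_le_sum fun i _ => hpiece i
    _ = M * N f := by simp

end IsRINorm

lemma vol01_fract_add_le {a : ℝ} (ha : a ∈ Ico (0 : ℝ) 1) (S : Set ℝ) :
    vol01 {θ | Int.fract (θ + a) ∈ S} ≤ vol01 S := by
  have hsub : {θ | Int.fract (θ + a) ∈ S} ∩ Ioo 0 1 ⊆
      (fun θ => θ + a) ⁻¹' ((S ∩ Ico 0 1) \ Iio a) ∪
        (fun θ => θ + (a - 1)) ⁻¹' ((S ∩ Ico 0 1) ∩ Iio a) := by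
    rintro θ ⟨hS, h0, h1⟩
    rw [mem_ofPred_eq] at hS
    rcases lt_or_ge (θ + a) 1 with h | h
    · left
      rw [Int.fract_eq_self.2 ⟨by linarith [ha.1], h⟩] at hS
      exact ⟨⟨hS, by linarith [ha.1], h⟩, by simp only [mem_Iio]; linarith⟩
    · right
      have : Int.fract (θ + a) = θ + (a - 1) := by
        rw [Int.fract_eq_iff]
        exact ⟨by linarith, by linarith [ha.2], 1, by push_cast; ring⟩
      rw [this] at hS
      exact ⟨⟨hS, by linarith, by linarith [ha.2]⟩, by simp only [mem_Iio]; linarith⟩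
  rw [vol01_apply, vol01_apply_Ico]
  calc _ ≤ _ := measure_mono hsub
    _ ≤ _ := measure_union_le _ _
    _ = volume ((S ∩ Ico 0 1) \ Iio a) + volume ((S ∩ Ico 0 1) ∩ Iio a) :=
        congrArg₂ (· + ·) (measure_preimage_add_right volume a _)
          (measure_preimage_add_right volume (a - 1) _)
    _ = _ := by rw [add_comm, measure_inter_add_sdiff _ measurableSet_Iio]

lemma lintegral_add_le_sum_fract {p : ℝ → ℝ≥0∞} (hp : Antitone p) (M : ℕ) (hM : M ≠ 0) (x : ℝ) :
    ∫⁻ θ, p (θ + 1 / M) ∂vol01 ≤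
      (M : ℝ≥0∞)⁻¹ * ∑ i ∈ Finset.range M, p (Int.fract (x + i / M)) := by
  have hMpos : (0 : ℝ) < M := by positivity
  set G : ℝ → ℝ≥0∞ := fun x => ∑ i ∈ Finset.range M, p (Int.fract (x + i / M)) with hG
  have hper : Function.Periodic G (1 / M) := by
    intro y
    have h1 : G (y + 1 / M) = ∑ i ∈ Finset.range M, p (Int.fract (y + (i + 1 : ℕ) / M)) := by
      refine Finset.sum_congr rfl fun i _ => ?_
      congr 2
      push_cast
      ring
    obtain ⟨K, rfl⟩ := Nat.exists_eq_succ_of_ne_zero hM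
    rw [h1, Finset.sum_range_succ, hG]
    simp only
    rw [Finset.sum_range_succ']
    congr 2
    rw [Nat.cast_zero, zero_div, add_zero, Nat.succ_eq_add_one, div_self (by positivity),
      Int.fract_add_one]
  have hx : G x = G (x - ⌊M * x⌋ • (1 / (M : ℝ))) := (hper.sub_zsmul_eq _).symm
  set θ₀ := x - ⌊M * x⌋ • (1 / (M : ℝ)) with hθ₀
  have h0 : θ₀ * M = Int.fract (M * x) := by
    rw [hθ₀, Int.fract]
    simp only [zsmul_eq_mul]
    field_simp
  have hθ0 : 0 ≤ θ₀ := by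
    by_contra! hc
    nlinarith [Int.fract_nonneg (M * x)]
  have hθ1 : θ₀ < 1 / M := by
    rw [lt_div_iff₀ hMpos, h0]
    exact Int.fract_lt_one _
  change _ ≤ _ * G x
  rw [hx]
  have hpt : ∀ᵐ θ ∂vol01, p (θ + 1 / M) ≤ ∑ c ∈ Finset.range M,
      (Ioc ((c : ℝ) / M) ((c + 1) / M)).indicator (fun _ => p ((c + 1) / M)) θ := by
    refine (ae_restrict_iff' measurableSet_Ioo).2 (Filter.Eventually.of_forall fun θ hθ => ?_)
    have hpos : 0 < M * θ := mul_pos hMpos hθ.1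
    have hc : 0 < ⌈M * θ⌉₊ := Nat.ceil_pos.2 hpos
    have hi : ⌈M * θ⌉₊ - 1 ∈ Finset.range M := by
      rw [Finset.mem_range]
      have : ⌈M * θ⌉₊ ≤ M := by
        rw [Nat.ceil_le]; nlinarith [hθ.2]
      omega
    refine le_trans ?_ (Finset.single_le_sum (fun _ _ => zero_le) hi)
    have h1 := Nat.ceil_lt_add_one hpos.le
    have h2 := Nat.le_ceil (M * θ)
    rw [Nat.cast_sub (Nat.succ_le_of_lt hc), Nat.cast_one, indicator_of_mem]
    · apply hp
      rw [div_le_iff₀ hMpos, add_mul, div_mul_cancel₀ _ hMpos.ne']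
      linarith
    · constructor
      · rw [div_lt_iff₀ hMpos]; linarith
      · rw [le_div_iff₀ hMpos]; linarith
  calc ∫⁻ θ, p (θ + 1 / M) ∂vol01
      ≤ ∫⁻ θ, ∑ c ∈ Finset.range M,
        (Ioc ((c : ℝ) / M) ((c + 1) / M)).indicator (fun _ => p ((c + 1) / M)) θ ∂vol01 :=
        lintegral_mono_ae hpt
    _ = ∑ c ∈ Finset.range M, p ((c + 1) / M) * vol01 (Ioc ((c : ℝ) / M) ((c + 1) / M)) := by
        rw [lintegral_finsetSum _ fun c _ => measurable_const.indicator measurableSet_Ioc]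
        simp_rw [lintegral_indicator_const measurableSet_Ioc]
    _ ≤ ∑ c ∈ Finset.range M, p ((c + 1) / M) * (M : ℝ≥0∞)⁻¹ := by
        refine Finset.sum_le_sum fun c _ => ?_
        gcongr
        refine (Measure.restrict_apply_le _ _).trans ?_
        rw [Real.volume_Ioc, ← sub_div, add_sub_cancel_left, one_div,
          ENNReal.ofReal_inv_of_pos hMpos, ENNReal.ofReal_natCast]
    _ = (M : ℝ≥0∞)⁻¹ * ∑ c ∈ Finset.range M, p ((c + 1) / M) := by
        rw [← Finset.sum_mul, mul_comm]
    _ ≤ _ := by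
        refine mul_le_mul_right (Finset.sum_le_sum fun c hc => hp ?_) _
        rw [Finset.mem_range] at hc
        have hcM : (c : ℝ) + 1 ≤ M := by exact_mod_cast hc
        have h3 : θ₀ + c / M < (c + 1) / M := by rw [add_div]; linarith
        rw [Int.fract_eq_self.2 ⟨by positivity, h3.trans_le ((div_le_one hMpos).2 hcM)⟩]
        exact h3.le

lemma lintegral_le_lintegral_distRearr {α : Type*} [MeasurableSpace α] (η : Measure α)
    {c : ℝ} (hc : 0 < c) (hη : η univ ≤ ENNReal.ofReal c) {h : α → ℝ≥0∞} (hm : Measurable h)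
    {B : ℝ≥0∞} (hB : B ≠ ⊤) (hhB : ∀ x, h x ≤ B) :
    ∫⁻ x, h x ∂η ≤ ENNReal.ofReal c * ∫⁻ θ, distRearr η h (c * θ) ∂vol01 := by
  have hrB : ∀ s, distRearr η h s ≤ B := by
    intro s
    by_contra! hcon
    rw [lt_distRearr_iff] at hcon
    have : {x | B < h x} = ∅ := by
      ext x; simpa using hhB x
    simp [this] at hcon
  have hrm : Measurable fun θ => distRearr η h (c * θ) := by
    refine Antitone.measurable fun s t hst => distRearr_antitone η h ?_
    gcongr
  have key : ∀ {β : Type _} [MeasurableSpace β] (κ : Measure β) (f : β → ℝ≥0∞),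
      Measurable f → (∀ x, f x ≤ B) →
      ∫⁻ x, f x ∂κ = ∫⁻ t in Ioi (0 : ℝ), κ {x | ENNReal.ofReal t < f x} := by
    intro β _ κ f hf hfB
    have h1 := lintegral_eq_lintegral_meas_lt κ (f := fun x => (f x).toReal)
      (Filter.Eventually.of_forall fun x => ENNReal.toReal_nonneg) hf.ennreal_toReal.aemeasurable
    have h2 : ∀ x, f x ≠ ⊤ := fun x => ne_top_of_le_ne_top hB (hfB x)
    simp_rw [ENNReal.ofReal_toReal (h2 _)] at h1
    rw [h1]
    refine setLIntegral_congr_fun measurableSet_Ioi fun t ht => ?_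
    simp_rw [ENNReal.ofReal_lt_iff_lt_toReal (le_of_lt ht) (h2 _)]
  have key2 : ∫⁻ θ, distRearr η h (c * θ) ∂vol01 =
      ∫⁻ t in Ioi (0 : ℝ), vol01 {θ | ENNReal.ofReal t < distRearr η h (c * θ)} := by
    have h1 := lintegral_eq_lintegral_meas_lt vol01 (f := fun θ => (distRearr η h (c * θ)).toReal)
      (Filter.Eventually.of_forall fun x => ENNReal.toReal_nonneg) hrm.ennreal_toReal.aemeasurable
    have h2 : ∀ x, distRearr η h x ≠ ⊤ := fun x => ne_top_of_le_ne_top hB (hrB x)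
    simp_rw [ENNReal.ofReal_toReal (h2 _)] at h1
    rw [h1]
    refine setLIntegral_congr_fun measurableSet_Ioi fun t ht => ?_
    simp_rw [ENNReal.ofReal_lt_iff_lt_toReal (le_of_lt ht) (h2 _)]
  rw [key η h hm hhB, key2, ← lintegral_const_mul' _ _ ENNReal.ofReal_ne_top]
  refine lintegral_mono fun t => ?_
  simp only
  rw [vol01_lt_distRearr hc, min_eq_right]
  · rw [ENNReal.mul_div_cancel (by simpa using hc) ENNReal.ofReal_ne_top]
  · refine ENNReal.div_le_of_le_mul ?_
    rw [one_mul]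
    exact (measure_mono (subset_univ _)).trans hη

namespace IsRINorm

variable {N : (ℝ → ℝ≥0∞) → ℝ≥0∞}

/-- Averaging over dyadic intervals is bounded. -/
lemma lintegral_dyadic_le (hN : IsRINorm N) {p : ℕ → ℝ → ℝ≥0∞} (hp : ∀ k, Antitone (p k))
    (hpc : ∀ k θ, ⨆ M : ℕ, p k (θ + 1 / (M + 1 : ℕ)) = p k θ) {g : ℝ → ℝ≥0∞}
    (hg : ∀ ρ, ∑' k, (2⁻¹ : ℝ≥0∞) ^ (k + 1) * vol01 {θ | ρ < p k θ} ≤ vol01 {t | ρ < g t}) :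
    N (fun t => ∫⁻ θ, p (dyadicIndex t) θ ∂vol01) ≤ N g := by
  have hmono : ∀ k θ, Monotone fun M : ℕ => p k (θ + 1 / (M + 1 : ℕ)) := by
    intro k θ M M' h
    apply hp
    gcongr
  have hsup := hN.iSup_eq
    (fun M t => ∫⁻ θ, p (dyadicIndex t) (θ + 1 / (M + 1 : ℕ)) ∂vol01)
    (fun t => ∫⁻ θ, p (dyadicIndex t) θ ∂vol01)
    (fun M => Filter.Eventually.of_forall fun t =>
      lintegral_mono fun θ => hmono _ _ (Nat.le_succ M))
    (Filter.Eventually.of_forall fun t => by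
      rw [← lintegral_iSup]
      · simp_rw [hpc]
      · intro M
        exact (hp _).measurable.comp (measurable_id.add_const _)
      · exact fun M M' h θ => hmono _ θ h)
  rw [hsup]
  refine iSup_le fun M => ?_
  have hM : M + 1 ≠ 0 := M.succ_ne_zero
  calc N (fun t => ∫⁻ θ, p (dyadicIndex t) (θ + 1 / (M + 1 : ℕ)) ∂vol01)
      ≤ N (fun t => (((M + 1 : ℕ) : ℝ≥0)⁻¹ : ℝ≥0) * ∑ i ∈ Finset.range (M + 1),
          p (dyadicIndex t) (Int.fract (dyadicPos t + i / (M + 1 : ℕ)))) := by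
        refine hN.mono _ _ (Filter.Eventually.of_forall fun t => ?_)
        rw [ENNReal.coe_inv (by positivity), ENNReal.coe_natCast]
        exact lintegral_add_le_sum_fract (hp _) (M + 1) hM _
    _ ≤ (((M + 1 : ℕ) : ℝ≥0)⁻¹ : ℝ≥0) * ∑ i ∈ Finset.range (M + 1), N g := by
        rw [hN.smul]
        gcongr
        refine (hN.sum_le _ _).trans (Finset.sum_le_sum fun i hi => hN.le_of_dist_le fun ρ => ?_)
        refine (vol01_dyadic_le
          fun k θ => ρ < p k (Int.fract (θ + i / (M + 1 : ℕ)))).trans ((hg ρ).trans' ?_)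
        refine ENNReal.tsum_le_tsum fun k => mul_le_mul_right ?_ _
        refine vol01_fract_add_le (S := {θ | ρ < p k θ}) ⟨by positivity, ?_⟩
        rw [div_lt_one (by positivity)]
        exact_mod_cast Finset.mem_range.1 hi
    _ = N g := by
        rw [Finset.sum_const, Finset.card_range, nsmul_eq_mul, ENNReal.coe_inv (by positivity),
          ENNReal.coe_natCast, ← mul_assoc, ENNReal.inv_mul_cancel (by simp) (by simp), one_mul]

end IsRINorm

lemma iSup_distRearr_add {α : Type*} [MeasurableSpace α] (η : Measure α) (h : α → ℝ≥0∞)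
    {c : ℝ} (hc : 0 < c) (θ : ℝ) :
    ⨆ M : ℕ, distRearr η h (c * (θ + 1 / (M + 1 : ℕ))) = distRearr η h (c * θ) := by
  refine le_antisymm (iSup_le fun M => distRearr_antitone η h ?_) ?_
  · gcongr
    simp only [le_add_iff_nonneg_right]
    positivity
  · refine le_of_forall_lt fun ρ hρ => ?_
    rw [lt_distRearr_iff] at hρ
    rw [lt_iSup_iff]
    simp_rw [lt_distRearr_iff]
    have ht : Filter.Tendsto (fun M : ℕ => ENNReal.ofReal (c * (θ + 1 / (M + 1 : ℕ))))
        Filter.atTop (nhds (ENNReal.ofReal (c * (θ + 0)))) := by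
      refine ENNReal.tendsto_ofReal (Filter.Tendsto.const_mul _ (Filter.Tendsto.const_add _ ?_))
      simpa using tendsto_one_div_add_atTop_nhds_zero_nat (𝕜 := ℝ)
    rw [add_zero] at ht
    exact (ht.eventually (gt_mem_nhds hρ)).exists

/-- Dyadic averages of `h` against a substochastic family of kernels are controlled by `h` in
every rearrangement-invariant norm. -/
lemma exists_kernel_average_le {V : ℝ} (hV : 0 < V) (C : ℝ≥0) : ∃ K : ℝ≥0,
    ∀ {N : (ℝ → ℝ≥0∞) → ℝ≥0∞}, IsRINorm N →
    ∀ {α : Type*} [MeasurableSpace α] (ν : Measure α), ν univ ≤ ENNReal.ofReal V →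
    ∀ {h : α → ℝ≥0∞} {B : ℝ≥0∞}, Measurable h → B ≠ ⊤ → (∀ x, h x ≤ B) →
    ∀ ω : ℕ → α → ℝ≥0∞, (∀ k, Measurable (ω k)) → (∀ x, ∑' k, ω k x ≤ C) →
      (∀ k, ∫⁻ x, ω k x ∂ν ≤ C * 2⁻¹ ^ k) →
      N (fun t => 2 ^ dyadicIndex t * ∫⁻ x, h x * ω (dyadicIndex t) x ∂ν) ≤
        K * N (fun t => distRearr ν h (V * t)) := by
  set W : ℝ≥0 := V.toNNReal with hW
  have hWV : (W : ℝ≥0∞) = ENNReal.ofReal V := rfl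
  have hW0 : W ≠ 0 := by simpa [hW] using hV
  obtain ⟨C₀, hC₀, hC1, hC2⟩ : ∃ C₀ : ℝ≥0, C₀ ≠ 0 ∧ C ≤ C₀ ∧ C ≤ C₀ * (W / 2) := by
    refine ⟨C + 1 + C * (2 / W), by positivity, ?_, ?_⟩
    · rw [add_assoc]; exact le_self_add
    · calc C = C * (2 / W) * (W / 2) := by field_simp
        _ ≤ _ := by gcongr; exact le_add_self
  refine ⟨C₀ * (W / 2), fun {N} hN {α} _ ν hν {h} {B} hh hB hhB ω hωm hωs hωi => ?_⟩
  set η : ℕ → Measure α := fun k => ν.withDensity fun x => (C₀⁻¹ : ℝ≥0) * ω k x with hη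
  set c : ℕ → ℝ := fun k => V * 2⁻¹ ^ (k + 1) with hc
  have hcpos : ∀ k, 0 < c k := fun k => by positivity
  have hcE : ∀ k, ENNReal.ofReal (c k) = W * 2⁻¹ ^ (k + 1) := by
    intro k
    rw [hc, hWV, ENNReal.ofReal_mul hV.le, ENNReal.ofReal_pow (by norm_num),
      ENNReal.ofReal_inv_of_pos two_pos, ENNReal.ofReal_ofNat]
  have hkm : ∀ k, Measurable fun x => ((C₀⁻¹ : ℝ≥0) : ℝ≥0∞) * ω k x :=
    fun k => (hωm k).const_mul _
  have hηu : ∀ k, η k univ ≤ ENNReal.ofReal (c k) := by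
    intro k
    rw [hη, withDensity_apply _ MeasurableSet.univ, Measure.restrict_univ,
      lintegral_const_mul _ (hωm k), hcE]
    calc ((C₀⁻¹ : ℝ≥0) : ℝ≥0∞) * ∫⁻ x, ω k x ∂ν
        ≤ (C₀⁻¹ : ℝ≥0) * ((C₀ * (W / 2) : ℝ≥0) * 2⁻¹ ^ k) := by
          gcongr
          exact (hωi k).trans (by gcongr)
      _ = ((C₀⁻¹ * (C₀ * (W / 2)) : ℝ≥0) : ℝ≥0∞) * 2⁻¹ ^ k := by
          push_cast; ring
      _ = W * 2⁻¹ ^ (k + 1) := by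
          rw [inv_mul_cancel_left₀ hC₀, pow_succ', ENNReal.coe_div two_ne_zero, div_eq_mul_inv]
          push_cast; ring
  have hint : ∀ k, ∫⁻ x, h x * ω k x ∂ν = C₀ * ∫⁻ x, h x ∂(η k) := by
    intro k
    rw [hη, lintegral_withDensity_eq_lintegral_mul _ (hkm k) hh,
      ← lintegral_const_mul _ ((hkm k).mul hh)]
    refine lintegral_congr fun x => ?_
    simp only [Pi.mul_apply]
    rw [← mul_assoc, ← mul_assoc, ← ENNReal.coe_mul, mul_inv_cancel₀ hC₀]
    simp [mul_comm]
  set g : ℝ → ℝ≥0∞ := fun t => distRearr ν h (V * t) with hg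
  have havg := hN.lintegral_dyadic_le (p := fun k θ => distRearr (η k) h (c k * θ)) (g := g)
    (fun k s t hst => distRearr_antitone _ _ (by gcongr))
    (fun k θ => iSup_distRearr_add _ _ (hcpos k) θ) (fun ρ => by
      have hms : MeasurableSet {x | ρ < h x} := measurableSet_lt measurable_const hh
      have hV0 : ENNReal.ofReal V ≠ 0 := by simpa using hV
      rw [hg, vol01_lt_distRearr hV, min_eq_right]
      · calc ∑' k, (2⁻¹ : ℝ≥0∞) ^ (k + 1) * vol01 {θ | ρ < distRearr (η k) h (c k * θ)}
            ≤ ∑' k, η k {x | ρ < h x} / ENNReal.ofReal V := by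
              refine ENNReal.tsum_le_tsum fun k => ?_
              rw [vol01_lt_distRearr (hcpos k)]
              refine (mul_le_mul_right (min_le_right _ _) _).trans_eq ?_
              rw [hcE, ← hWV, div_eq_mul_inv, div_eq_mul_inv,
                ENNReal.mul_inv (Or.inr (by simp)) (Or.inr (by simp))]
              rw [mul_comm, mul_assoc, mul_assoc, ENNReal.inv_mul_cancel (by simp) (by simp),
                mul_one]
          _ = (∑' k, η k {x | ρ < h x}) / ENNReal.ofReal V := by
              simp_rw [div_eq_mul_inv]
              rw [ENNReal.tsum_mul_right]
          _ ≤ ν {x | ρ < h x} / ENNReal.ofReal V := by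
              gcongr
              simp_rw [hη, withDensity_apply _ hms]
              rw [← lintegral_tsum fun k => (hkm k).aemeasurable]
              calc ∫⁻ x in {x | ρ < h x}, ∑' k, ((C₀⁻¹ : ℝ≥0) : ℝ≥0∞) * ω k x ∂ν
                  ≤ ∫⁻ x in {x | ρ < h x}, 1 ∂ν := by
                    refine lintegral_mono fun x => ?_
                    rw [ENNReal.tsum_mul_left]
                    calc ((C₀⁻¹ : ℝ≥0) : ℝ≥0∞) * ∑' k, ω k x ≤ (C₀⁻¹ : ℝ≥0) * (C₀ : ℝ≥0) := by
                          gcongr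
                          exact (hωs x).trans (by gcongr)
                      _ = 1 := by
                          rw [← ENNReal.coe_mul, inv_mul_cancel₀ hC₀, ENNReal.coe_one]
                _ = ν {x | ρ < h x} := by simp
      · refine ENNReal.div_le_of_le_mul ?_
        rw [one_mul]
        exact (measure_mono (subset_univ _)).trans hν)
  calc N (fun t => 2 ^ dyadicIndex t * ∫⁻ x, h x * ω (dyadicIndex t) x ∂ν)
      ≤ N (fun t => (C₀ * (W / 2) : ℝ≥0) *
          ∫⁻ θ, distRearr (η (dyadicIndex t)) h (c (dyadicIndex t) * θ) ∂vol01) := by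
        refine hN.mono _ _ (Filter.Eventually.of_forall fun t => ?_)
        generalize dyadicIndex t = k
        rw [hint]
        have := lintegral_le_lintegral_distRearr (η k) (hcpos k) (hηu k) hh hB hhB
        calc (2 : ℝ≥0∞) ^ k * (C₀ * ∫⁻ x, h x ∂(η k))
            ≤ 2 ^ k * (C₀ * (ENNReal.ofReal (c k) *
              ∫⁻ θ, distRearr (η k) h (c k * θ) ∂vol01)) := by gcongr
          _ = (2 ^ k * 2⁻¹ ^ k) * ((C₀ * (W * 2⁻¹)) *
              ∫⁻ θ, distRearr (η k) h (c k * θ) ∂vol01) := by rw [hcE, pow_succ]; ring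
          _ = ((C₀ * (W / 2) : ℝ≥0) : ℝ≥0∞) *
                ∫⁻ θ, distRearr (η k) h (c k * θ) ∂vol01 := by
              rw [← mul_pow, ENNReal.mul_inv_cancel (by simp) (by simp), one_pow, one_mul,
                ENNReal.coe_mul, ENNReal.coe_div two_ne_zero, ← div_eq_mul_inv, ENNReal.coe_ofNat]
    _ ≤ _ := by
        rw [hN.smul]
        gcongr

/-- `v` is controlled, with order `m` and constant `C`, by averages of `h` against kernels `ω j` of
mass `O(2⁻ʲ)` over nested sets `D j` of measure `O(2⁻ʲ)`. -/
def KernelBound {α : Type*} [MeasurableSpace α] (ν : Measure α) (q : ℝ≥0∞) (C : ℝ≥0) (m : ℕ)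
    (v h : α → ℝ≥0∞) : Prop :=
  ∃ (D : ℕ → Set α) (ω : ℕ → α → ℝ≥0∞), (∀ j, MeasurableSet (D j)) ∧ Antitone D ∧
    (∀ j, Measurable (ω j)) ∧ (∀ j, ν (D j) ≤ C * 2⁻¹ ^ j) ∧ (∀ x, ∑' j, ω j x ≤ C) ∧
    (∀ j, ∫⁻ x, ω j x ∂ν ≤ C * 2⁻¹ ^ j) ∧
    ∀ x, v x ≤ C * ∑' j, q ^ (m * j) * 2 ^ j * (∫⁻ y, h y * ω j y ∂ν) * (D j).indicator 1 x

lemma tsum_ite_le_pow_le {q : ℝ≥0∞} (k : ℕ) :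
    ∑' j, (if j < k then (0 : ℝ≥0∞) else q ^ j) = q ^ k * (1 - q)⁻¹ := by
  rw [← ENNReal.tsum_geometric, ← ENNReal.tsum_mul_left,
    ← Summable.sum_add_tsum_nat_add' (k := k) ENNReal.summable, Finset.sum_eq_zero, zero_add]
  · refine tsum_congr fun j => ?_
    rw [if_neg (by omega), pow_add, mul_comm]
  · intro j hj
    rw [if_pos (Finset.mem_range.1 hj)]

lemma KernelBound.comp {α : Type*} [MeasurableSpace α] {ν : Measure α} {q : ℝ≥0∞} (hq : q < 1)
    (C₁ C₂ : ℝ≥0) :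
    ∃ C : ℝ≥0, ∀ {m : ℕ} {v w h : α → ℝ≥0∞}, Measurable h → KernelBound ν q C₁ 1 v w →
      KernelBound ν q C₂ m w h → KernelBound ν q C (m + 1) v h := by
  obtain ⟨Q, hQ⟩ : ∃ Q : ℝ≥0, (Q : ℝ≥0∞) = (1 - q)⁻¹ :=
    ENNReal.canLift.prf _ (ENNReal.inv_ne_top.2 (tsub_pos_of_lt hq).ne')
  refine ⟨C₁ + (2 * (C₁ * C₂ ^ 2) + C₂) + C₁ * C₂ * (1 + C₁ * Q), fun {m v w h} hh h1 h2 => ?_⟩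
  set C := C₁ + (2 * (C₁ * C₂ ^ 2) + C₂) + C₁ * C₂ * (1 + C₁ * Q) with hC
  obtain ⟨D, ω, hDm, hDa, hωm, hD, hωs, hωi, hv⟩ := h1
  obtain ⟨D', ω', hDm', hDa', hωm', hD', hωs', hωi', hw⟩ := h2
  set a : ℕ → ℕ → ℝ≥0∞ := fun j k => ∫⁻ x in D' k, ω j x ∂ν with ha
  have ha1 : ∀ j k, a j k ≤ C₁ * 2⁻¹ ^ j := fun j k =>
    (setLIntegral_le_lintegral _ _).trans (hωi j)
  have ha2 : ∀ k, ∑' j, a j k ≤ C₁ * C₂ * 2⁻¹ ^ k := fun k => by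
    rw [ha, ← lintegral_tsum fun j => (hωm j).aemeasurable]
    calc ∫⁻ x in D' k, ∑' j, ω j x ∂ν ≤ ∫⁻ x in D' k, C₁ ∂ν := lintegral_mono fun x => hωs x
      _ = C₁ * ν (D' k) := by simp
      _ ≤ C₁ * (C₂ * 2⁻¹ ^ k) := by gcongr; exact hD' k
      _ = _ := by ring
  have h22 : ∀ k : ℕ, (2 : ℝ≥0∞) ^ k * 2⁻¹ ^ k = 1 := fun k => by
    rw [← mul_pow, ENNReal.mul_inv_cancel (by simp) (by simp), one_pow]
  set η : ℕ → α → ℝ≥0∞ := fun j x => ∑' k, (if j ≤ k then 2 ^ k * a j k else 0) * ω' k x with hη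
  have hηm : ∀ j, Measurable (η j) := fun j =>
    Measurable.tsum fun k => (hωm' k).const_mul _
  have hηs : ∀ x, ∑' j, η j x ≤ C₁ * C₂ ^ 2 := fun x => by
    rw [hη, ENNReal.tsum_comm]
    calc ∑' k, ∑' j, (if j ≤ k then 2 ^ k * a j k else 0) * ω' k x
        ≤ ∑' k, C₁ * C₂ * ω' k x := by
          refine ENNReal.tsum_le_tsum fun k => ?_
          rw [ENNReal.tsum_mul_right]
          gcongr
          calc ∑' j, (if j ≤ k then 2 ^ k * a j k else 0) ≤ ∑' j, 2 ^ k * a j k := by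
                refine ENNReal.tsum_le_tsum fun j => ?_
                split_ifs <;> simp
            _ ≤ 2 ^ k * (C₁ * C₂ * 2⁻¹ ^ k) := by
                rw [ENNReal.tsum_mul_left]; gcongr; exact ha2 k
            _ = C₁ * C₂ * (2 ^ k * 2⁻¹ ^ k) := by ring
            _ = _ := by rw [h22, mul_one]
      _ ≤ C₁ * C₂ * C₂ := by rw [ENNReal.tsum_mul_left]; gcongr; exact hωs' x
      _ = _ := by ring
  have hηi : ∀ j, ∫⁻ x, η j x ∂ν ≤ 2 * (C₁ * C₂ ^ 2) * 2⁻¹ ^ j := fun j => by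
    rw [hη, lintegral_tsum fun k => ((hωm' k).const_mul _).aemeasurable]
    calc ∑' k, ∫⁻ x, (if j ≤ k then 2 ^ k * a j k else 0) * ω' k x ∂ν
        ≤ ∑' k, (C₁ : ℝ≥0∞) * (C₂ : ℝ≥0∞) ^ 2 * (if j ≤ k then 2⁻¹ ^ k else 0) := by
          refine ENNReal.tsum_le_tsum fun k => ?_
          rw [lintegral_const_mul _ (hωm' k)]
          split_ifs
          · calc 2 ^ k * a j k * ∫⁻ x, ω' k x ∂ν
                ≤ 2 ^ k * (C₁ * C₂ * 2⁻¹ ^ k) * (C₂ * 2⁻¹ ^ k) := by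
                  gcongr
                  · exact (ENNReal.le_tsum j).trans (ha2 k)
                  · exact hωi' k
              _ = C₁ * C₂ ^ 2 * 2⁻¹ ^ k * (2 ^ k * 2⁻¹ ^ k) := by ring
              _ = _ := by rw [h22, mul_one]
          · simp
      _ = _ := by rw [ENNReal.tsum_mul_left, tsum_inv_two_pow_ge]; ring
  refine ⟨D, fun j x => η j x + ω' j x, hDm, hDa, fun j => (hηm j).add (hωm' j), fun j => ?_,
    fun x => ?_, fun j => ?_, fun x => ?_⟩
  · refine (hD j).trans ?_
    gcongr
    rw [hC, add_assoc]
    exact le_self_add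
  · rw [ENNReal.tsum_add]
    calc ∑' j, η j x + ∑' j, ω' j x ≤ C₁ * C₂ ^ 2 + C₂ := add_le_add (hηs x) (hωs' x)
      _ ≤ 2 * (C₁ * C₂ ^ 2) + C₂ := by
          rw [two_mul (C₁ * C₂ ^ 2 : ℝ≥0∞)]
          exact add_le_add_left le_self_add _
      _ ≤ C := by
          rw [hC]; norm_cast
          exact le_trans le_add_self le_self_add
  · rw [lintegral_add_left (hηm j)]
    calc ∫⁻ x, η j x ∂ν + ∫⁻ x, ω' j x ∂ν ≤ 2 * (C₁ * C₂ ^ 2) * 2⁻¹ ^ j + C₂ * 2⁻¹ ^ j :=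
          add_le_add (hηi j) (hωi' j)
      _ = (2 * (C₁ * C₂ ^ 2) + C₂) * 2⁻¹ ^ j := by ring
      _ ≤ C * 2⁻¹ ^ j := by
          gcongr
          rw [hC]; norm_cast
          exact le_trans le_add_self le_self_add
  · set H : ℕ → ℝ≥0∞ := fun k => ∫⁻ y, h y * ω' k y ∂ν with hH
    set I : ℕ → ℝ≥0∞ := fun j => (D j).indicator 1 x with hI
    have hIa : Antitone I := fun i j hij =>
      indicator_le_indicator_of_subset (hDa hij) (fun _ => zero_le) x
    have hηH : ∀ j, ∫⁻ y, h y * η j y ∂ν = ∑' k, (if j ≤ k then 2 ^ k * a j k else 0) * H k := by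
      intro j
      simp_rw [hη, ← ENNReal.tsum_mul_left]
      have hm' : ∀ k, AEMeasurable
          (fun y => h y * ((if j ≤ k then 2 ^ k * a j k else 0) * ω' k y)) ν := fun k =>
        (hh.mul ((hωm' k).const_mul _)).aemeasurable
      rw [lintegral_tsum hm']
      refine tsum_congr fun k => ?_
      have hm'' : Measurable fun y => h y * ω' k y := hh.mul (hωm' k)
      simp only [hH]
      rw [← lintegral_const_mul _ hm'']
      refine lintegral_congr fun y => ?_
      ring
    have hwω : ∀ j, ∫⁻ y, w y * ω j y ∂ν ≤ C₂ * ∑' k, q ^ (m * k) * 2 ^ k * H k * a j k := by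
      intro j
      calc ∫⁻ y, w y * ω j y ∂ν
          ≤ ∫⁻ y, C₂ * ∑' k, q ^ (m * k) * 2 ^ k * H k * (D' k).indicator (ω j) y ∂ν := by
            refine lintegral_mono fun y => ?_
            refine (mul_le_mul_left (hw y) _).trans_eq ?_
            rw [mul_assoc, ← ENNReal.tsum_mul_right]
            congr 1
            refine tsum_congr fun k => ?_
            by_cases hy : y ∈ D' k <;> simp [hy, hH]
        _ = _ := by
            have hm' : ∀ k, Measurable fun y =>
                q ^ (m * k) * 2 ^ k * H k * (D' k).indicator (ω j) y := fun k =>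
              ((hωm j).indicator (hDm' k)).const_mul _
            rw [lintegral_const_mul _ (Measurable.tsum hm'),
              lintegral_tsum fun k => (hm' k).aemeasurable]
            congr 1
            refine tsum_congr fun k => ?_
            rw [lintegral_const_mul _ ((hωm j).indicator (hDm' k)), lintegral_indicator (hDm' k)]
    have hfar : ∑' j, q ^ j * 2 ^ j * I j * ∑' k, (if k < j then q ^ (m * k) * 2 ^ k * H k * a j k
          else 0) ≤ C₁ * Q * ∑' k, q ^ ((m + 1) * k) * 2 ^ k * H k * I k := by
      calc ∑' j, q ^ j * 2 ^ j * I j * ∑' k, (if k < j then q ^ (m * k) * 2 ^ k * H k * a j k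
            else 0)
          ≤ ∑' j, ∑' k, C₁ * (q ^ (m * k) * 2 ^ k * H k * I k) * (if j < k then 0 else q ^ j) := by
            refine ENNReal.tsum_le_tsum fun j => ?_
            rw [← ENNReal.tsum_mul_left]
            refine ENNReal.tsum_le_tsum fun k => ?_
            split_ifs with h3 h4 h4
            · omega
            · calc q ^ j * 2 ^ j * I j * (q ^ (m * k) * 2 ^ k * H k * a j k)
                  ≤ q ^ j * 2 ^ j * I k * (q ^ (m * k) * 2 ^ k * H k * (C₁ * 2⁻¹ ^ j)) := by
                    gcongr
                    · exact hIa h3.le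
                    · exact ha1 j k
                _ = (2 ^ j * 2⁻¹ ^ j) * (C₁ * (q ^ (m * k) * 2 ^ k * H k * I k) * q ^ j) := by ring
                _ = _ := by rw [h22, one_mul]
            · simp
            · simp
        _ = _ := by
            rw [ENNReal.tsum_comm, ← ENNReal.tsum_mul_left]
            refine tsum_congr fun k => ?_
            rw [ENNReal.tsum_mul_left, tsum_ite_le_pow_le, ← hQ]
            ring
    have hnear : ∑' j, q ^ j * 2 ^ j * I j * ∑' k, (if j ≤ k then q ^ (m * k) * 2 ^ k * H k * a j k
          else 0) ≤ ∑' j, q ^ ((m + 1) * j) * 2 ^ j * (∫⁻ y, h y * η j y ∂ν) * I j := by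
      refine ENNReal.tsum_le_tsum fun j => ?_
      calc q ^ j * 2 ^ j * I j * ∑' k, (if j ≤ k then q ^ (m * k) * 2 ^ k * H k * a j k else 0)
          ≤ q ^ j * 2 ^ j * I j * (q ^ (m * j) * ∫⁻ y, h y * η j y ∂ν) := by
            rw [hηH, ← ENNReal.tsum_mul_left (a := q ^ (m * j))]
            refine mul_le_mul_right (ENNReal.tsum_le_tsum fun k => ?_) _
            split_ifs with h3
            · calc q ^ (m * k) * 2 ^ k * H k * a j k ≤ q ^ (m * j) * 2 ^ k * H k * a j k := by
                    gcongr ?_ * _ * _ * _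
                    exact pow_le_pow_right_of_le_one' hq.le (Nat.mul_le_mul_left m h3)
                _ = _ := by ring
            · simp
        _ = _ := by ring
    calc v x ≤ C₁ * ∑' j, q ^ (1 * j) * 2 ^ j * (∫⁻ y, w y * ω j y ∂ν) * I j := hv x
      _ ≤ C₁ * ∑' j, q ^ (1 * j) * 2 ^ j * (C₂ * ∑' k, q ^ (m * k) * 2 ^ k * H k * a j k) * I j := by
          gcongr with j
          exact hwω j
      _ = C₁ * C₂ * (∑' j, q ^ j * 2 ^ j * I j *
            ∑' k, (if k < j then q ^ (m * k) * 2 ^ k * H k * a j k else 0) +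
          ∑' j, q ^ j * 2 ^ j * I j *
            ∑' k, (if j ≤ k then q ^ (m * k) * 2 ^ k * H k * a j k else 0)) := by
          rw [← ENNReal.tsum_add, mul_assoc, ← ENNReal.tsum_mul_left (a := (C₂ : ℝ≥0∞))]
          congr 1
          refine tsum_congr fun j => ?_
          rw [← mul_add, ← ENNReal.tsum_add, one_mul]
          have : ∀ k, (if k < j then q ^ (m * k) * 2 ^ k * H k * a j k else 0) +
              (if j ≤ k then q ^ (m * k) * 2 ^ k * H k * a j k else 0) =
              q ^ (m * k) * 2 ^ k * H k * a j k := fun k => by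
            rcases lt_or_ge k j with h3 | h3
            · rw [if_pos h3, if_neg h3.not_ge, add_zero]
            · rw [if_neg h3.not_gt, if_pos h3, zero_add]
          simp_rw [this]
          ring
      _ ≤ C₁ * C₂ * (C₁ * Q * (∑' k, q ^ ((m + 1) * k) * 2 ^ k * H k * I k) +
            ∑' j, q ^ ((m + 1) * j) * 2 ^ j * (∫⁻ y, h y * η j y ∂ν) * I j) := by gcongr
      _ ≤ C₁ * C₂ * ((1 + C₁ * Q) * ∑' j, q ^ ((m + 1) * j) * 2 ^ j *
            (∫⁻ y, h y * (η j y + ω' j y) ∂ν) * I j) := by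
          rw [add_mul (1 : ℝ≥0∞), one_mul, add_comm]
          gcongr with j j
          · exact le_self_add
          · refine lintegral_mono fun y => ?_
            rw [mul_add]
            exact le_add_self
      _ = (C₁ * C₂ * (1 + C₁ * Q) : ℝ≥0) * ∑' j, q ^ ((m + 1) * j) * 2 ^ j *
            (∫⁻ y, h y * (η j y + ω' j y) ∂ν) * I j := by
          push_cast; ring
      _ ≤ C * ∑' j, q ^ ((m + 1) * j) * 2 ^ j *
            (∫⁻ y, h y * (η j y + ω' j y) ∂ν) * I j := by
          gcongr
          exact le_add_self

lemma exists_abs_deriv_smoothTransition_le :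
    ∃ K : ℝ≥0, ∀ x, |deriv Real.smoothTransition x| ≤ K ∧
      (x ∉ Icc (0 : ℝ) 1 → deriv Real.smoothTransition x = 0) := by
  have hc : Continuous (deriv Real.smoothTransition) :=
    (Real.smoothTransition.contDiff (n := 1)).continuous_deriv le_rfl
  obtain ⟨K, hK⟩ := (isCompact_Icc (a := (0 : ℝ)) (b := 1)).exists_bound_of_continuousOn
    hc.continuousOn
  have h0 : ∀ x, x ∉ Icc (0 : ℝ) 1 → deriv Real.smoothTransition x = 0 := by
    intro x hx
    rw [mem_Icc, not_and_or, not_le, not_le] at hx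
    rcases hx with hx | hx
    · have : Real.smoothTransition =ᶠ[nhds x] fun _ => 0 := by
        filter_upwards [Iio_mem_nhds hx] with y hy
        exact Real.smoothTransition.zero_of_nonpos (le_of_lt hy)
      rw [this.deriv_eq, deriv_const]
    · have : Real.smoothTransition =ᶠ[nhds x] fun _ => 1 := by
        filter_upwards [Ioi_mem_nhds hx] with y hy
        exact Real.smoothTransition.one_of_one_le (le_of_lt hy)
      rw [this.deriv_eq, deriv_const]
  refine ⟨K.toNNReal, fun x => ⟨?_, h0 x⟩⟩
  by_cases hx : x ∈ Icc (0 : ℝ) 1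
  · exact (hK x hx).trans (Real.le_coe_toNNReal K)
  · rw [h0 x hx, abs_zero]
    exact NNReal.coe_nonneg _

lemma exists_level_set_sobolev {n : ℕ} (hn : 2 ≤ n) :
    ∃ C : ℝ≥0, ∀ {F : Type*} [NormedAddCommGroup F] [InnerProductSpace ℝ F]
      {w : EuclideanSpace ℝ (Fin n) → F}, ContDiff ℝ 1 w → HasCompactSupport w →
      ∀ {a b : ℝ}, 0 ≤ a → a < b →
      ENNReal.ofReal (b - a) * volume {x | (a + 2 * b) / 3 < ‖w x‖} ^ (1 - 1 / (n : ℝ)) ≤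
        C * ∫⁻ x in {x | a < ‖w x‖ ∧ ‖w x‖ ≤ b}, ‖fderiv ℝ w x‖ₑ := by
  obtain ⟨K, hK⟩ := exists_abs_deriv_smoothTransition_le
  set p : ℝ := Real.conjExponent n with hp
  have hn1 : (1 : ℝ) < n := by exact_mod_cast hn
  have hpc : Real.HolderConjugate (Module.finrank ℝ (EuclideanSpace ℝ (Fin n))) p := by
    rw [finrank_euclideanSpace_fin]
    exact Real.HolderConjugate.conjExponent hn1
  have hpc' : Real.HolderConjugate n p := Real.HolderConjugate.conjExponent hn1
  have hp0 : 0 < p := hpc'.symm.pos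
  have hpi : p⁻¹ = 1 - 1 / (n : ℝ) := by
    rw [one_div]; linarith [hpc'.inv_add_inv_eq_one]
  set S : ℝ≥0 := lintegralPowLePowLIntegralFDerivConst
    (volume : Measure (EuclideanSpace ℝ (Fin n))) p with hS
  refine ⟨S ^ p⁻¹ * (6 * K), fun {F _ _ w} hw hwc {a b} ha hab => ?_⟩
  set α := (2 * a + b) / 3 with hα
  set β := (a + 2 * b) / 3 with hβ
  have hα0 : 0 < α := by rw [hα]; linarith
  have haα : a < α := by rw [hα]; linarith
  have hαβ : α < β := by rw [hα, hβ]; linarith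
  have hβb : β < b := by rw [hβ]; linarith
  have hΔ : 0 < β ^ 2 - α ^ 2 := by nlinarith
  set φ : EuclideanSpace ℝ (Fin n) → ℝ := fun x => (‖w x‖ ^ 2 - α ^ 2) / (β ^ 2 - α ^ 2) with hφ
  set ψ : EuclideanSpace ℝ (Fin n) → ℝ := fun x => Real.smoothTransition (φ x) with hψ
  have hφC : ContDiff ℝ 1 φ := ((hw.norm_sq ℝ).sub contDiff_const).div_const _
  have hψC : ContDiff ℝ 1 ψ := Real.smoothTransition.contDiff.comp hφC
  have hψs : HasCompactSupport ψ := by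
    refine hwc.mono fun x hx => ?_
    contrapose! hx
    rw [Function.notMem_support] at hx ⊢
    refine Real.smoothTransition.zero_of_nonpos (div_nonpos_of_nonpos_of_nonneg ?_ hΔ.le)
    simp [hx, sq_nonneg]
  have hψd : ∀ x, ‖fderiv ℝ ψ x‖ₑ ≤ {x | a < ‖w x‖ ∧ ‖w x‖ ≤ b}.indicator
      (fun x => ENNReal.ofReal (6 * K / (b - a)) * ‖fderiv ℝ w x‖ₑ) x := by
    intro x
    have hwd : HasFDerivAt w (fderiv ℝ w x) x :=
      (hw.differentiable one_ne_zero x).hasFDerivAt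
    have h1 : HasFDerivAt φ ((β ^ 2 - α ^ 2)⁻¹ • (2 • (innerSL ℝ (w x)).comp (fderiv ℝ w x))) x := by
      have := (hwd.norm_sq.sub_const (α ^ 2)).mul_const (β ^ 2 - α ^ 2)⁻¹
      simpa [hφ, div_eq_mul_inv] using this
    have h2 : HasFDerivAt ψ (deriv Real.smoothTransition (φ x) •
        ((β ^ 2 - α ^ 2)⁻¹ • (2 • (innerSL ℝ (w x)).comp (fderiv ℝ w x)))) x :=
      ((Real.smoothTransition.contDiff (n := 1)).differentiable one_ne_zero
        (φ x)).hasDerivAt.comp_hasFDerivAt x h1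
    rw [h2.fderiv]
    by_cases hx : φ x ∈ Icc (0 : ℝ) 1
    · have hx1 : α ^ 2 ≤ ‖w x‖ ^ 2 := by
        have := (le_div_iff₀ hΔ).1 hx.1
        linarith
      have hx2 : ‖w x‖ ^ 2 ≤ β ^ 2 := by
        have := (div_le_one hΔ).1 hx.2
        linarith
      have hx1' : α ≤ ‖w x‖ := le_of_sq_le_sq hx1 (norm_nonneg _)
      have hx2' : ‖w x‖ ≤ β := le_of_sq_le_sq hx2 (hα0.trans hαβ).le
      rw [indicator_of_mem (show x ∈ {x | a < ‖w x‖ ∧ ‖w x‖ ≤ b} from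
        ⟨haα.trans_le hx1', hx2'.trans hβb.le⟩)]
      rw [← ofReal_norm, ← ofReal_norm, ← ENNReal.ofReal_mul (by
        have := K.coe_nonneg; have := sub_pos.2 hab; positivity)]
      refine ENNReal.ofReal_le_ofReal ?_
      rw [norm_smul, norm_smul, Real.norm_eq_abs, Real.norm_eq_abs, abs_of_pos (inv_pos.2 hΔ)]
      have h3 : ‖2 • (innerSL ℝ (w x)).comp (fderiv ℝ w x)‖ ≤ 2 * (β * ‖fderiv ℝ w x‖) := by
        rw [two_smul]
        refine (norm_add_le _ _).trans ?_
        have : ‖(innerSL ℝ (w x)).comp (fderiv ℝ w x)‖ ≤ β * ‖fderiv ℝ w x‖ := by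
          refine (ContinuousLinearMap.opNorm_comp_le _ _).trans ?_
          rw [innerSL_apply_norm]
          gcongr
        linarith
      calc |deriv Real.smoothTransition (φ x)| * ((β ^ 2 - α ^ 2)⁻¹ *
            ‖2 • (innerSL ℝ (w x)).comp (fderiv ℝ w x)‖)
          ≤ K * ((β ^ 2 - α ^ 2)⁻¹ * (2 * (β * ‖fderiv ℝ w x‖))) := by
            gcongr
            exact (hK _).1
        _ = K * ‖fderiv ℝ w x‖ * (2 * β / (β ^ 2 - α ^ 2)) := by field_simp
        _ ≤ K * ‖fderiv ℝ w x‖ * (6 / (b - a)) := by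
            gcongr ?_ * ?_
            rw [div_le_div_iff₀ hΔ (sub_pos.2 hab)]
            have : β ^ 2 - α ^ 2 = (b - a) / 3 * (α + β) := by rw [hα, hβ]; ring
            rw [this]
            nlinarith [mul_pos (sub_pos.2 hab) hα0]
        _ = _ := by ring
    · rw [(hK _).2 hx, zero_smul, ← ofReal_norm, norm_zero,
        ENNReal.ofReal_zero]
      exact zero_le
  have hsob := lintegral_pow_le_pow_lintegral_fderiv
    (volume : Measure (EuclideanSpace ℝ (Fin n))) hψC hψs hpc
  rw [← hS] at hsob
  have hms : MeasurableSet {x | a < ‖w x‖ ∧ ‖w x‖ ≤ b} :=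
    (measurableSet_lt measurable_const hw.continuous.norm.measurable).inter
      (measurableSet_le hw.continuous.norm.measurable measurable_const)
  have hup : ∫⁻ x, ‖fderiv ℝ ψ x‖ₑ ≤ ENNReal.ofReal (6 * K / (b - a)) *
      ∫⁻ x in {x | a < ‖w x‖ ∧ ‖w x‖ ≤ b}, ‖fderiv ℝ w x‖ₑ := by
    refine (lintegral_mono hψd).trans_eq ?_
    rw [lintegral_indicator hms, lintegral_const_mul' _ _ ENNReal.ofReal_ne_top]
  have hlow : volume {x | β < ‖w x‖} ≤ ∫⁻ x, ‖ψ x‖ₑ ^ p := by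
    have hms' : MeasurableSet {x | β < ‖w x‖} :=
      measurableSet_lt measurable_const hw.continuous.norm.measurable
    rw [← lintegral_indicator_one hms']
    refine lintegral_mono fun x => ?_
    by_cases hx : β < ‖w x‖
    · have : ψ x = 1 := by
        refine Real.smoothTransition.one_of_one_le ((one_le_div hΔ).2 ?_)
        have := hα0.trans hαβ
        nlinarith
      simp [this, hx]
    · simp [hx]
  have hroot : volume {x | β < ‖w x‖} ^ (1 - 1 / (n : ℝ)) ≤ (S ^ p⁻¹ : ℝ≥0) *
      (ENNReal.ofReal (6 * K / (b - a)) *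
        ∫⁻ x in {x | a < ‖w x‖ ∧ ‖w x‖ ≤ b}, ‖fderiv ℝ w x‖ₑ) := by
    rw [← hpi]
    calc volume {x | β < ‖w x‖} ^ p⁻¹ ≤ (S * (∫⁻ x, ‖fderiv ℝ ψ x‖ₑ) ^ p) ^ p⁻¹ := by
          gcongr
          exact hlow.trans hsob
      _ = (S ^ p⁻¹ : ℝ≥0) * ∫⁻ x, ‖fderiv ℝ ψ x‖ₑ := by
          rw [ENNReal.mul_rpow_of_nonneg _ _ (inv_nonneg.2 hp0.le), ENNReal.rpow_rpow_inv hp0.ne',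
            ENNReal.coe_rpow_of_nonneg _ (inv_nonneg.2 hp0.le)]
      _ ≤ _ := by gcongr
  calc ENNReal.ofReal (b - a) * volume {x | β < ‖w x‖} ^ (1 - 1 / (n : ℝ))
      ≤ ENNReal.ofReal (b - a) * ((S ^ p⁻¹ : ℝ≥0) * (ENNReal.ofReal (6 * K / (b - a)) *
        ∫⁻ x in {x | a < ‖w x‖ ∧ ‖w x‖ ≤ b}, ‖fderiv ℝ w x‖ₑ)) := by gcongr
    _ = (S ^ p⁻¹ : ℝ≥0) * (ENNReal.ofReal (b - a) * ENNReal.ofReal (6 * K / (b - a))) *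
        ∫⁻ x in {x | a < ‖w x‖ ∧ ‖w x‖ ≤ b}, ‖fderiv ℝ w x‖ₑ := by ring
    _ = _ := by
        rw [← ENNReal.ofReal_mul (sub_pos.2 hab).le, mul_div_cancel₀ _ (sub_pos.2 hab).ne',
          ENNReal.ofReal_mul (by norm_num), ENNReal.ofReal_coe_nnreal]
        push_cast
        norm_num

lemma le_tsum_sub_ite {A : ℕ → ℝ≥0∞} (h0 : A 0 = 0) {y : ℝ≥0∞} (hy : y ≤ ⨆ k, A k) :
    y ≤ ∑' k, (A (k + 1) - A k) * (if A k < y then 1 else 0) := by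
  have key : ∀ N, min (A N) y ≤ ∑ k ∈ Finset.range N, (A (k + 1) - A k) *
      (if A k < y then 1 else 0) := by
    intro N
    induction N with
    | zero => simp [h0]
    | succ N ih =>
      rw [Finset.sum_range_succ]
      refine le_trans ?_ (add_le_add_left ih _)
      split_ifs with h
      · rw [min_eq_left h.le, mul_one]
        exact (min_le_left _ _).trans le_add_tsub
      · rw [min_eq_right (not_lt.1 h)]
        exact (min_le_right _ _).trans le_self_add
  refine le_of_forall_lt fun c hc => ?_
  obtain ⟨N, hN⟩ := lt_iSup_iff.1 (hc.trans_le hy)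
  exact (lt_min hN hc).trans_le ((key N).trans (ENNReal.sum_le_tsum _))

/-- The ratio `2^(-1/n)` in which lengths shrink when volumes are halved. -/
noncomputable def halvingRatio (n : ℕ) : ℝ≥0∞ := 2⁻¹ ^ (1 / (n : ℝ))

lemma halvingRatio_lt_one {n : ℕ} (hn : n ≠ 0) : halvingRatio n < 1 :=
  ENNReal.rpow_lt_one (by simp) (by positivity)

lemma halvingRatio_pos (n : ℕ) : 0 < halvingRatio n :=
  ENNReal.rpow_pos (by simp) (by simp)

lemma halvingRatio_pow_eq (n k : ℕ) : halvingRatio n ^ k = (2⁻¹ ^ k) ^ (1 / (n : ℝ)) := by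
  rw [halvingRatio, ← ENNReal.rpow_natCast, ← ENNReal.rpow_natCast, ← ENNReal.rpow_mul,
    ← ENNReal.rpow_mul, mul_comm]

lemma inv_two_pow_rpow_one_sub (n k : ℕ) :
    ((2⁻¹ : ℝ≥0∞) ^ k) ^ (1 - 1 / (n : ℝ)) * (halvingRatio n ^ k * 2 ^ k) = 1 := by
  rw [ENNReal.rpow_sub _ _ (by simp) (by simp), ENNReal.rpow_one, ← halvingRatio_pow_eq,
    div_eq_mul_inv]
  have h0 : halvingRatio n ^ k ≠ 0 := pow_ne_zero _ (halvingRatio_pos n).ne'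
  have h1 : halvingRatio n ^ k ≠ ⊤ := by
    rw [halvingRatio_pow_eq]
    exact ENNReal.rpow_ne_top_of_nonneg (by positivity) (by simp)
  calc (2⁻¹ : ℝ≥0∞) ^ k * (halvingRatio n ^ k)⁻¹ * (halvingRatio n ^ k * 2 ^ k)
      = (2⁻¹ * 2) ^ k * ((halvingRatio n ^ k)⁻¹ * halvingRatio n ^ k) := by
        rw [mul_pow]; ring
    _ = 1 := by rw [ENNReal.inv_mul_cancel h0 h1, ENNReal.inv_mul_cancel (by simp) (by simp)]; simp

lemma exists_kernelBound_fderiv {n : ℕ} (hn : 2 ≤ n) {V : ℝ} (hV : 0 < V) :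
    ∃ C : ℝ≥0, ∀ {F : Type*} [NormedAddCommGroup F] [InnerProductSpace ℝ F]
      {w : EuclideanSpace ℝ (Fin n) → F}, ContDiff ℝ 1 w → HasCompactSupport w →
      volume (Function.support w) ≤ ENNReal.ofReal V →
      KernelBound volume (halvingRatio n) C 1 (fun x => ‖w x‖ₑ) (fun x => ‖fderiv ℝ w x‖ₑ) := by
  obtain ⟨S, hS⟩ := exists_level_set_sobolev hn
  have hn0 : n ≠ 0 := by omega
  have hn1 : (0 : ℝ) ≤ 1 - 1 / (n : ℝ) := by
    have : (2 : ℝ) ≤ n := by exact_mod_cast hn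
    rw [sub_nonneg, div_le_one (by linarith)]; linarith
  set W : ℝ≥0 := V.toNNReal with hW
  have hWV : ENNReal.ofReal V = W := rfl
  have hW0 : W ≠ 0 := by simpa [hW] using hV
  set W' : ℝ≥0 := W ^ (1 - 1 / (n : ℝ)) with hW'
  have hW'0 : W' ≠ 0 := by simp [hW', NNReal.rpow_eq_zero_iff, hW0]
  refine ⟨1 + W + 2 * (W'⁻¹ * S), fun {F _ _ w} hw hwc hsupp => ?_⟩
  have hcn : Continuous fun x => ‖w x‖ₑ := hw.continuous.enorm
  obtain ⟨B, hB⟩ : ∃ B : ℝ≥0, ∀ x, ‖w x‖ₑ ≤ B := by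
    obtain ⟨B, hB⟩ := hw.continuous.bounded_above_of_compact_support hwc
    refine ⟨B.toNNReal, fun x => ?_⟩
    rw [← ofReal_norm]
    exact ENNReal.ofReal_le_ofReal (hB x)
  have hsk : ∀ k : ℕ, ENNReal.ofReal (V * 2⁻¹ ^ k) = W * 2⁻¹ ^ k := fun k => by
    rw [ENNReal.ofReal_mul hV.le, ENNReal.ofReal_pow (by norm_num), hWV,
      ENNReal.ofReal_inv_of_pos (by norm_num)]
    norm_num
  set A : ℕ → ℝ≥0∞ := fun k => distRearr volume (fun x => ‖w x‖ₑ) (V * 2⁻¹ ^ k) with hA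
  have hAm : Monotone A := fun i j hij => distRearr_antitone _ _ (by
    gcongr ?_ * ?_
    exact pow_le_pow_of_le_one (by norm_num) (by norm_num) hij)
  have hAlt : ∀ k ρ, ρ < A k ↔ W * 2⁻¹ ^ k < volume {x | ρ < ‖w x‖ₑ} := fun k ρ => by
    rw [hA, lt_distRearr_iff, hsk]
  have hAB : ∀ k, A k ≤ B := fun k => by
    by_contra! h
    rw [hAlt] at h
    have : {x | (B : ℝ≥0∞) < ‖w x‖ₑ} = ∅ := by
      ext x; simpa using hB x
    rw [this, measure_empty] at h
    exact not_lt_zero h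
  have hA0 : A 0 = 0 := by
    by_contra h
    have := (hAlt 0 0).1 (pos_iff_ne_zero.2 h)
    rw [pow_zero, mul_one, ← hWV] at this
    refine absurd this (not_lt.2 (le_trans (measure_mono fun x hx => ?_) hsupp))
    have := mem_ofPred.1 hx
    rw [Function.mem_support]
    intro h0
    simp [h0] at this
  have hDv : ∀ k, volume {x | A k < ‖w x‖ₑ} ≤ W * 2⁻¹ ^ k := fun k =>
    not_lt.1 fun h => lt_irrefl _ ((hAlt k _).2 h)
  set ω : ℕ → EuclideanSpace ℝ (Fin n) → ℝ≥0∞ := fun k =>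
    {x | A k < ‖w x‖ₑ ∧ ‖w x‖ₑ ≤ A (k + 1)}.indicator 1 with hω
  have hωms : ∀ k, MeasurableSet {x | A k < ‖w x‖ₑ ∧ ‖w x‖ₑ ≤ A (k + 1)} := fun k =>
    (measurableSet_lt measurable_const hcn.measurable).inter
      (measurableSet_le hcn.measurable measurable_const)
  have hstep : ∀ k, A (k + 1) - A k ≤
      2 * (W'⁻¹ * S : ℝ≥0) * (halvingRatio n ^ k * 2 ^ k * ∫⁻ x, ‖fderiv ℝ w x‖ₑ * ω k x) := by
    intro k
    rcases (hAm k.le_succ).eq_or_lt with h | h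
    · rw [← h, tsub_self]; exact zero_le
    lift A k to ℝ≥0 using ((hAB k).trans_lt ENNReal.coe_lt_top).ne with a ha
    lift A (k + 1) to ℝ≥0 using ((hAB (k + 1)).trans_lt ENNReal.coe_lt_top).ne with b hb
    have hab : (a : ℝ) < b := by exact_mod_cast h
    have := hS hw hwc a.coe_nonneg hab
    have hset : {x | A k < ‖w x‖ₑ ∧ ‖w x‖ₑ ≤ A (k + 1)} = {x | (a : ℝ) < ‖w x‖ ∧ ‖w x‖ ≤ b} := by
      ext x
      rw [← ha, ← hb]
      simp only [enorm_eq_nnnorm, mem_ofPred_eq]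
      norm_cast
    have hint : ∫⁻ x in {x | (a : ℝ) < ‖w x‖ ∧ ‖w x‖ ≤ b}, ‖fderiv ℝ w x‖ₑ =
        ∫⁻ x, ‖fderiv ℝ w x‖ₑ * ω k x := by
      rw [← hset, ← lintegral_indicator (hωms k)]
      refine lintegral_congr fun x => ?_
      by_cases hx : x ∈ {x | A k < ‖w x‖ₑ ∧ ‖w x‖ₑ ≤ A (k + 1)}
      · simp only [hω, indicator_of_mem hx, Pi.one_apply, mul_one]
      · simp only [hω, indicator_of_notMem hx, mul_zero]
    have hvol : W * 2⁻¹ ^ (k + 1) ≤ volume {x | ((a : ℝ) + 2 * b) / 3 < ‖w x‖} := by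
      have h1 : ENNReal.ofReal ((a + 2 * b) / 3) < A (k + 1) := by
        rw [← hb, ← ENNReal.ofReal_coe_nnreal, ENNReal.ofReal_lt_ofReal_iff_of_nonneg]
        · linarith
        · positivity
      refine ((hAlt _ _).1 h1).le.trans (measure_mono fun x hx => ?_)
      have := mem_ofPred.1 hx
      rw [← ofReal_norm, ENNReal.ofReal_lt_ofReal_iff_of_nonneg (by positivity)] at this
      exact this
    have hsub : (b : ℝ≥0∞) - a = ENNReal.ofReal (b - a) := by
      rw [ENNReal.ofReal_sub _ a.coe_nonneg]; simp
    rw [hint] at this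
    rw [hsub]
    have hpow : ((W : ℝ≥0∞) * 2⁻¹ ^ (k + 1)) ^ (1 - 1 / (n : ℝ)) =
        W' * ((2⁻¹ : ℝ≥0∞) ^ (k + 1)) ^ (1 - 1 / (n : ℝ)) := by
      rw [ENNReal.mul_rpow_of_nonneg _ _ hn1, hW', ENNReal.coe_rpow_of_nonneg _ hn1]
    calc ENNReal.ofReal (b - a)
        = (W'⁻¹ * W' : ℝ≥0) * (((2⁻¹ : ℝ≥0∞) ^ (k + 1)) ^ (1 - 1 / (n : ℝ)) *
            (halvingRatio n ^ (k + 1) * 2 ^ (k + 1))) * ENNReal.ofReal (b - a) := by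
          rw [inv_two_pow_rpow_one_sub, inv_mul_cancel₀ hW'0]; simp
      _ = (W'⁻¹ : ℝ≥0) * (halvingRatio n ^ (k + 1) * 2 ^ (k + 1)) * (ENNReal.ofReal (b - a) *
            (W * 2⁻¹ ^ (k + 1)) ^ (1 - 1 / (n : ℝ))) := by
          rw [hpow, ENNReal.coe_mul]; ring
      _ ≤ (W'⁻¹ : ℝ≥0) * (halvingRatio n ^ (k + 1) * 2 ^ (k + 1)) *
            (S * ∫⁻ x, ‖fderiv ℝ w x‖ₑ * ω k x) := by
          refine mul_le_mul_right (le_trans ?_ this) _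
          exact mul_le_mul_right (ENNReal.rpow_le_rpow hvol hn1) _
      _ ≤ (W'⁻¹ : ℝ≥0) * (halvingRatio n ^ k * 2 ^ (k + 1)) *
            (S * ∫⁻ x, ‖fderiv ℝ w x‖ₑ * ω k x) := by
          refine mul_le_mul_left (mul_le_mul_right (mul_le_mul_left ?_ _) _) _
          exact pow_le_pow_right_of_le_one' (halvingRatio_lt_one hn0).le k.le_succ
      _ = _ := by rw [ENNReal.coe_mul, pow_succ]; ring
  refine ⟨fun k => {x | A k < ‖w x‖ₑ}, ω, fun k => measurableSet_lt measurable_const hcn.measurable,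
    fun i j hij x hx => (hAm hij).trans_lt (mem_ofPred.1 hx), fun k => measurable_one.indicator (hωms k),
    fun k => (hDv k).trans ?_, fun x => ?_, fun k => ?_, fun x => ?_⟩
  · gcongr
    exact le_trans le_add_self le_self_add
  · have h1 : ∑' k, ω k x ≤ 1 := by
      by_cases hx : ∃ k, A k < ‖w x‖ₑ ∧ ‖w x‖ₑ ≤ A (k + 1)
      · obtain ⟨k, hk⟩ := hx
        rw [tsum_eq_single k]
        · exact indicator_le_self' (fun _ _ => zero_le) x
        · intro j hj
          refine indicator_of_notMem (fun hxj => ?_) _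
          have hxj := mem_ofPred.1 hxj
          rcases lt_or_gt_of_ne hj with h | h
          · exact absurd (hk.1.trans_le (hxj.2.trans (hAm h))) (lt_irrefl _)
          · exact absurd (hxj.1.trans_le (hk.2.trans (hAm h))) (lt_irrefl _)
      · push Not at hx
        have : ∀ k, ω k x = 0 := fun k =>
          indicator_of_notMem (fun hxk => absurd (hx k (mem_ofPred.1 hxk).1)
            (not_lt.2 (mem_ofPred.1 hxk).2)) _
        simp [this]
    refine h1.trans ?_
    norm_cast
    exact le_trans le_self_add le_self_add
  · rw [hω, lintegral_indicator_one (hωms k)]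
    refine (measure_mono fun x hx => ?_).trans ((hDv k).trans ?_)
    · exact (mem_ofPred.1 hx).1
    · gcongr
      exact le_trans le_add_self le_self_add
  · have hsup : ‖w x‖ₑ ≤ ⨆ k, A k := by
      by_contra! h
      have hopen : IsOpen {y | (⨆ k, A k) < ‖w y‖ₑ} := isOpen_lt continuous_const hcn
      have hpos := hopen.measure_pos volume ⟨x, h⟩
      have hle : ∀ k : ℕ, volume {y | (⨆ k, A k) < ‖w y‖ₑ} ≤ W * 2⁻¹ ^ k := fun k =>
        le_trans (measure_mono fun y (hy : (⨆ k, A k) < ‖w y‖ₑ) => (le_iSup A k).trans_lt hy)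
          (hDv k)
      have htend : Filter.Tendsto (fun k : ℕ => (W : ℝ≥0∞) * 2⁻¹ ^ k) Filter.atTop (nhds 0) := by
        have := ENNReal.Tendsto.const_mul (a := (W : ℝ≥0∞))
          (ENNReal.tendsto_pow_atTop_nhds_zero_of_lt_one (r := 2⁻¹) (by simp))
          (Or.inr ENNReal.coe_ne_top)
        simpa using this
      exact absurd (ge_of_tendsto' htend hle) (not_le.2 hpos)
    refine (le_tsum_sub_ite hA0 hsup).trans ?_
    rw [← ENNReal.tsum_mul_left]
    refine ENNReal.tsum_le_tsum fun k => ?_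
    calc (A (k + 1) - A k) * (if A k < ‖w x‖ₑ then 1 else 0)
        ≤ 2 * (W'⁻¹ * S : ℝ≥0) * (halvingRatio n ^ k * 2 ^ k * ∫⁻ x, ‖fderiv ℝ w x‖ₑ * ω k x) *
          (if A k < ‖w x‖ₑ then 1 else 0) := by gcongr; exact hstep k
      _ = (2 * (W'⁻¹ * S) : ℝ≥0) * (halvingRatio n ^ (1 * k) * 2 ^ k *
          (∫⁻ x, ‖fderiv ℝ w x‖ₑ * ω k x) * {x | A k < ‖w x‖ₑ}.indicator 1 x) := by
          rw [one_mul, ENNReal.coe_mul 2, ENNReal.coe_ofNat]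
          simp only [indicator_apply, mem_ofPred_eq, Pi.one_apply]
          ring
      _ ≤ _ := by
          gcongr
          exact le_add_self

lemma KernelBound.mono_mul {α : Type*} [MeasurableSpace α] {ν : Measure α} {q : ℝ≥0∞} {C : ℝ≥0}
    {m : ℕ} {v h v' h' : α → ℝ≥0∞} (H : KernelBound ν q C m v h) {c c' : ℝ≥0}
    (hv : ∀ x, v' x ≤ c * v x) (hh : ∀ x, h x ≤ c' * h' x) :
    KernelBound ν q (C + c * C * c') m v' h' := by
  obtain ⟨D, ω, hDm, hDa, hωm, hD, hωs, hωi, hb⟩ := H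
  have hC : (C : ℝ≥0∞) ≤ (C + c * C * c' : ℝ≥0) := by norm_cast; exact le_self_add
  refine ⟨D, ω, hDm, hDa, hωm, fun j => (hD j).trans (by gcongr), fun x => (hωs x).trans hC,
    fun j => (hωi j).trans (by gcongr), fun x => ?_⟩
  calc v' x ≤ c * (C * ∑' j, q ^ (m * j) * 2 ^ j * (∫⁻ y, h y * ω j y ∂ν) *
        (D j).indicator 1 x) := (hv x).trans (by gcongr; exact hb x)
    _ ≤ c * (C * ∑' j, q ^ (m * j) * 2 ^ j * (c' * ∫⁻ y, h' y * ω j y ∂ν) *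
        (D j).indicator 1 x) := by
        gcongr with j
        rw [← lintegral_const_mul' _ _ ENNReal.coe_ne_top]
        refine lintegral_mono fun y => ?_
        rw [← mul_assoc]
        exact mul_le_mul_left (hh y) _
    _ = (c * C * c' : ℝ≥0) * ∑' j, q ^ (m * j) * 2 ^ j * (∫⁻ y, h' y * ω j y ∂ν) *
        (D j).indicator 1 x := by
        push_cast
        rw [← mul_assoc, mul_assoc (c * C : ℝ≥0∞), ← ENNReal.tsum_mul_left (a := (c' : ℝ≥0∞))]
        congr 1
        refine tsum_congr fun j => ?_
        ring
    _ ≤ _ := by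
        gcongr
        exact le_add_self

instance {n i : ℕ} : FiniteDimensional ℝ
    (ContinuousMultilinearMap ℝ (fun _ : Fin i => EuclideanSpace ℝ (Fin n)) ℝ) :=
  Module.Finite.of_injective
    (ContinuousMultilinearMap.toMultilinearMapLinear (R' := ℝ) (A := ℝ) :
      ContinuousMultilinearMap ℝ (fun _ : Fin i => EuclideanSpace ℝ (Fin n)) ℝ →ₗ[ℝ] _)
    ContinuousMultilinearMap.toMultilinearMap_injective

lemma exists_kernelBound_iteratedFDeriv_succ {n : ℕ} (hn : 2 ≤ n) {V : ℝ} (hV : 0 < V) (i : ℕ) :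
    ∃ C : ℝ≥0, ∀ {u : EuclideanSpace ℝ (Fin n) → ℝ}, ContDiff ℝ (⊤ : ℕ∞) u → HasCompactSupport u →
      volume (tsupport u) ≤ ENNReal.ofReal V →
      KernelBound volume (halvingRatio n) C 1 (fun x => ‖iteratedFDeriv ℝ i u x‖ₑ)
        (fun x => ‖iteratedFDeriv ℝ (i + 1) u x‖ₑ) := by
  obtain ⟨C, hC⟩ := exists_kernelBound_fderiv hn hV
  set L := toEuclidean (E := ContinuousMultilinearMap ℝ
    (fun _ : Fin i => EuclideanSpace ℝ (Fin n)) ℝ) with hL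
  refine ⟨C + ‖L.symm.toContinuousLinearMap‖₊ * C * ‖L.toContinuousLinearMap‖₊, fun {u} hu hus huV => ?_⟩
  have hui : ContDiff ℝ 1 (iteratedFDeriv ℝ i u) :=
    hu.iteratedFDeriv_right (by exact_mod_cast le_top)
  have hw : ContDiff ℝ 1 (fun x => L (iteratedFDeriv ℝ i u x)) := L.contDiff.comp hui
  have hwc : HasCompactSupport (fun x => L (iteratedFDeriv ℝ i u x)) :=
    (hus.iteratedFDeriv i).comp_left (map_zero L)
  have hws : volume (Function.support fun x => L (iteratedFDeriv ℝ i u x)) ≤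
      ENNReal.ofReal V := by
    refine (measure_mono fun x hx => ?_).trans huV
    refine support_iteratedFDeriv_subset i (𝕜 := ℝ) ?_
    rw [Function.mem_support] at hx ⊢
    contrapose! hx
    rw [hx, map_zero]
  refine (hC hw hwc hws).mono_mul (fun x => ?_) fun x => ?_
  · have := L.symm.toContinuousLinearMap.le_opENorm (L (iteratedFDeriv ℝ i u x))
    rwa [ContinuousLinearEquiv.coe_coe, L.symm_apply_apply] at this
  · have h1 : fderiv ℝ (fun x => L (iteratedFDeriv ℝ i u x)) x =
        L.toContinuousLinearMap.comp (fderiv ℝ (iteratedFDeriv ℝ i u) x) :=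
      L.comp_fderiv
    have h2 : ‖iteratedFDeriv ℝ (i + 1) u x‖ₑ = ‖fderiv ℝ (iteratedFDeriv ℝ i u) x‖ₑ := by
      rw [← ofReal_norm, ← ofReal_norm, norm_fderiv_iteratedFDeriv]
    rw [h1, h2, enorm_eq_nnnorm, enorm_eq_nnnorm]
    rw [← ENNReal.coe_mul, ENNReal.coe_le_coe]
    exact ContinuousLinearMap.opNNNorm_comp_le L.toContinuousLinearMap _

lemma exists_kernelBound_iteratedFDeriv {n : ℕ} (hn : 2 ≤ n) {V : ℝ} (hV : 0 < V) (m i : ℕ) :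
    ∃ C : ℝ≥0, ∀ {u : EuclideanSpace ℝ (Fin n) → ℝ}, ContDiff ℝ (⊤ : ℕ∞) u → HasCompactSupport u →
      volume (tsupport u) ≤ ENNReal.ofReal V →
      KernelBound volume (halvingRatio n) C (m + 1) (fun x => ‖iteratedFDeriv ℝ i u x‖ₑ)
        (fun x => ‖iteratedFDeriv ℝ (i + (m + 1)) u x‖ₑ) := by
  induction m generalizing i with
  | zero => exact exists_kernelBound_iteratedFDeriv_succ hn hV i
  | succ m ih =>
    obtain ⟨C₁, h₁⟩ := exists_kernelBound_iteratedFDeriv_succ hn hV i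
    obtain ⟨C₂, h₂⟩ := ih (i + 1)
    obtain ⟨C, hC⟩ := KernelBound.comp (α := EuclideanSpace ℝ (Fin n)) (ν := volume)
      (halvingRatio_lt_one (n := n) (by omega)) C₁ C₂
    refine ⟨C, fun {u} hu hus huV => ?_⟩
    have h₂' := h₂ hu hus huV
    rw [show i + 1 + (m + 1) = i + (m + 1 + 1) by ring] at h₂'
    refine hC ?_ (h₁ hu hus huV) h₂'
    exact (hu.continuous_iteratedFDeriv (by exact_mod_cast le_top)).enorm.measurable

lemma exists_radial_measure_le {n : ℕ} (hn : 2 ≤ n) {d : ℝ}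
    {Ω : Set (EuclideanSpace ℝ (Fin n))} (hΩ : IsOpen Ω)
    {x₀ : EuclideanSpace ℝ (Fin n)} (hx₀ : x₀ ∈ Ω)
    {g : ℝ → ℝ} (hg : AntitoneOn g (Ioi 0)) {μ : Measure (EuclideanSpace ℝ (Fin n))}
    (hμ : μ = (volume.restrict Ω).withDensity fun x => ENNReal.ofReal (g ‖x - x₀‖))
    {A : ℝ} (hA : ∀ r : ℝ, 0 < r → μ (Metric.ball x₀ r ∩ Ω) ≤ ENNReal.ofReal (A * r ^ d))
    (C : ℝ≥0) :
    ∃ C' : ℝ≥0, ∀ (j : ℕ) (D : Set (EuclideanSpace ℝ (Fin n))), MeasurableSet D →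
      volume D ≤ C * 2⁻¹ ^ j → μ D ≤ C' * ENNReal.ofReal (((2⁻¹ : ℝ) ^ (d / n)) ^ j) := by
  have hn0 : (0 : ℝ) < n := by exact_mod_cast (by omega : 0 < n)
  have : Nontrivial (EuclideanSpace ℝ (Fin n)) := by
    have : Nontrivial (Fin n) := Fin.nontrivial_iff_two_le.2 hn
    infer_instance
  obtain ⟨r₀, hr₀, hball⟩ := Metric.isOpen_iff.1 hΩ x₀ hx₀
  set b : ℝ≥0∞ := ENNReal.ofReal (r₀ ^ n) * volume (Metric.ball (0 : EuclideanSpace ℝ (Fin n)) 1)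
    with hb
  have hb0 : b ≠ 0 := mul_ne_zero (by simpa using pow_pos hr₀ n)
    (Metric.measure_ball_pos _ _ one_pos).ne'
  have hbT : b ≠ ⊤ := ENNReal.mul_ne_top ENNReal.ofReal_ne_top measure_ball_lt_top.ne
  have hC'T : ENNReal.ofReal (A * r₀ ^ d) * (1 + C * b⁻¹) ≠ ⊤ :=
    ENNReal.mul_ne_top ENNReal.ofReal_ne_top (ENNReal.add_ne_top.2 ⟨ENNReal.one_ne_top,
      ENNReal.mul_ne_top ENNReal.coe_ne_top (ENNReal.inv_ne_top.2 hb0)⟩)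
  refine ⟨(ENNReal.ofReal (A * r₀ ^ d) * (1 + C * b⁻¹)).toNNReal, fun j D hD hDv => ?_⟩
  rw [ENNReal.coe_toNNReal hC'T]
  set κ : ℝ := (2⁻¹ : ℝ) ^ (1 / (n : ℝ)) with hκ
  have hκ0 : 0 < κ := Real.rpow_pos_of_pos (by norm_num) _
  have hκ1 : κ ≤ 1 := Real.rpow_le_one (by norm_num) (by norm_num) (by positivity)
  have hκn : κ ^ n = 2⁻¹ := by
    rw [hκ, ← Real.rpow_natCast, ← Real.rpow_mul (by norm_num), one_div,
      inv_mul_cancel₀ hn0.ne', Real.rpow_one]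
  have hκd : κ ^ d = (2⁻¹ : ℝ) ^ (d / n) := by
    rw [hκ, ← Real.rpow_mul (by norm_num)]; congr 1; ring
  set r : ℝ := r₀ * κ ^ j with hr
  have hr0 : 0 < r := by positivity
  have hrr : r ≤ r₀ := mul_le_of_le_one_right hr₀.le (pow_le_one₀ hκ0.le hκ1)
  have hrd : ENNReal.ofReal (A * r ^ d) =
      ENNReal.ofReal (A * r₀ ^ d) * ENNReal.ofReal (((2⁻¹ : ℝ) ^ (d / n)) ^ j) := by
    rw [← ENNReal.ofReal_mul' (by positivity), ← hκd, hr, Real.mul_rpow hr₀.le (by positivity),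
      ← Real.rpow_natCast, ← Real.rpow_natCast, ← Real.rpow_mul hκ0.le, ← Real.rpow_mul hκ0.le,
      mul_comm d, mul_assoc]
  have hbr : volume (Metric.ball x₀ r) = b * 2⁻¹ ^ j := by
    rw [Measure.addHaar_ball _ _ hr0.le, finrank_euclideanSpace_fin, hr, mul_pow, ← pow_mul,
      mul_comm j n, pow_mul, hκn, ENNReal.ofReal_mul (by positivity),
      ENNReal.ofReal_pow (p := (2⁻¹ : ℝ)) (by norm_num), ENNReal.ofReal_inv_of_pos (by norm_num),
      ENNReal.ofReal_ofNat, hb]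
    ring
  have hμs : ∀ s, MeasurableSet s →
      μ s = ∫⁻ x in s ∩ Ω, ENNReal.ofReal (g ‖x - x₀‖) := fun s hs => by
    rw [hμ, withDensity_apply _ hs, Measure.restrict_restrict hs]
  have hgr : ENNReal.ofReal (g r) * (b * 2⁻¹ ^ j) ≤ ENNReal.ofReal (A * r ^ d) := by
    refine le_trans ?_ (hA r hr0)
    have hsub : Metric.ball x₀ r ⊆ Ω := (Metric.ball_subset_ball hrr).trans hball
    rw [inter_eq_left.2 hsub, hμs _ measurableSet_ball, inter_eq_left.2 hsub, ← hbr,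
      ← setLIntegral_const]
    refine lintegral_mono_ae ?_
    refine (ae_restrict_iff' measurableSet_ball).2 ?_
    filter_upwards [Measure.ae_ne volume x₀] with x hx hxr
    refine ENNReal.ofReal_le_ofReal (hg (norm_pos_iff.2 (sub_ne_zero.2 hx)) hr0 ?_)
    rw [← dist_eq_norm]
    exact (Metric.mem_ball.1 hxr).le
  have hout : μ (D \ Metric.ball x₀ r) ≤ ENNReal.ofReal (g r) * volume D := by
    rw [hμs _ (hD.diff measurableSet_ball), ← setLIntegral_const]
    refine le_trans (setLIntegral_mono' ((hD.diff measurableSet_ball).inter hΩ.measurableSet)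
      (g := fun _ => ENNReal.ofReal (g r)) fun x hx => ?_) (lintegral_mono_set fun x hx => hx.1.1)
    have hxr : r ≤ ‖x - x₀‖ := by
      rw [← dist_eq_norm]
      exact not_lt.1 fun h => hx.1.2 (Metric.mem_ball.2 h)
    exact ENNReal.ofReal_le_ofReal (hg hr0 (hr0.trans_le hxr) hxr)
  have hin : μ (D ∩ Metric.ball x₀ r) ≤ ENNReal.ofReal (A * r ^ d) := by
    refine le_trans ?_ (hA r hr0)
    rw [hμs _ (hD.inter measurableSet_ball), hμs _ (measurableSet_ball.inter hΩ.measurableSet)]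
    exact lintegral_mono_set fun x hx => ⟨⟨hx.1.2, hx.2⟩, hx.2⟩
  calc μ D = μ (D ∩ Metric.ball x₀ r) + μ (D \ Metric.ball x₀ r) :=
        (measure_inter_add_sdiff D measurableSet_ball).symm
    _ ≤ ENNReal.ofReal (A * r ^ d) + ENNReal.ofReal (g r) * (C * 2⁻¹ ^ j) :=
        add_le_add hin (hout.trans (by gcongr))
    _ = ENNReal.ofReal (A * r ^ d) +
          C * b⁻¹ * (ENNReal.ofReal (g r) * (b * 2⁻¹ ^ j)) := by
        congr 1
        calc ENNReal.ofReal (g r) * (C * 2⁻¹ ^ j)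
            = (b⁻¹ * b) * (ENNReal.ofReal (g r) * (C * 2⁻¹ ^ j)) := by
              rw [ENNReal.inv_mul_cancel hb0 hbT, one_mul]
          _ = _ := by ring
    _ ≤ ENNReal.ofReal (A * r ^ d) + C * b⁻¹ * ENNReal.ofReal (A * r ^ d) := by gcongr
    _ = _ := by rw [hrd]; ring

/-- The least non-increasing function on `(0,1)` that is at least `F j` to the left of `2⁻ʲ`. -/
noncomputable def dyadicStep (F : ℕ → ℝ≥0∞) (s : ℝ) : ℝ≥0∞ :=
  ⨆ j, (Iio ((2⁻¹ : ℝ) ^ j)).indicator (fun _ => F j) s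

lemma measurable_dyadicStep (F : ℕ → ℝ≥0∞) : Measurable (dyadicStep F) :=
  Measurable.iSup fun _ => measurable_const.indicator measurableSet_Iio

lemma antitone_dyadicStep (F : ℕ → ℝ≥0∞) : Antitone (dyadicStep F) := fun s t hst =>
  iSup_mono fun j => by
    by_cases ht : t ∈ Iio ((2⁻¹ : ℝ) ^ j)
    · rw [indicator_of_mem ht, indicator_of_mem (show s ∈ Iio ((2⁻¹ : ℝ) ^ j) from lt_of_le_of_lt hst ht)]
    · rw [indicator_of_notMem ht]; exact zero_le

lemma le_dyadicStep (F : ℕ → ℝ≥0∞) {j : ℕ} {s : ℝ} (hs : s < 2⁻¹ ^ j) : F j ≤ dyadicStep F s :=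
  le_iSup_of_le j (indicator_of_mem (mem_Iio.2 hs) (fun _ => F j)).ge

lemma IsRINorm.dyadicStep_le {N : (ℝ → ℝ≥0∞) → ℝ≥0∞} (hN : IsRINorm N) (F : ℕ → ℝ≥0∞) :
    N (dyadicStep F) ≤ 4 * N (fun t => F (dyadicIndex t)) := by
  have := hN.le_mul_of_dist_le_mul (f := fun t => F (dyadicIndex t)) (g := dyadicStep F) 4
    (by norm_num) fun ρ => ?_
  · exact_mod_cast this
  by_cases hj : ∃ j, ρ < F j
  · classical
    set k := Nat.find hj with hk
    have h1 : vol01 {t | ρ < dyadicStep F t} ≤ 2⁻¹ ^ k := by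
      have hsub : {t | ρ < dyadicStep F t} ⊆ Iio ((2⁻¹ : ℝ) ^ k) := by
        intro t ht
        obtain ⟨j, hj'⟩ := lt_iSup_iff.1 (mem_ofPred.1 ht)
        by_cases htj : t ∈ Iio ((2⁻¹ : ℝ) ^ j)
        · rw [indicator_of_mem htj] at hj'
          exact lt_of_lt_of_le (mem_Iio.1 htj)
            (pow_le_pow_of_le_one (by norm_num : (0 : ℝ) ≤ 2⁻¹) (by norm_num) (Nat.find_min' hj hj'))
        · rw [indicator_of_notMem htj] at hj'
          exact absurd hj' not_lt_zero
      refine (measure_mono hsub).trans_eq ?_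
      rw [vol01_Iio (pow_le_one₀ (by norm_num) (by norm_num)), ENNReal.ofReal_pow (by norm_num),
        ENNReal.ofReal_inv_of_pos (by norm_num), ENNReal.ofReal_ofNat]
    have h2 : (2⁻¹ : ℝ≥0∞) ^ (k + 1) ≤ vol01 {t | ρ < F (dyadicIndex t)} := by
      have hsub : Ioo ((2⁻¹ : ℝ) ^ (k + 1)) (2⁻¹ ^ k) ⊆ {t | ρ < F (dyadicIndex t)} ∩ Ioo 0 1 := by
        intro t ht
        have ht01 : t ∈ Ioo (0 : ℝ) 1 :=
          ⟨lt_trans (by positivity) ht.1, ht.2.trans_le (pow_le_one₀ (by norm_num) (by norm_num))⟩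
        refine ⟨?_, ht01⟩
        rw [mem_ofPred, (dyadicIndex_eq_iff ht01 k).2 ⟨ht.1, ht.2.le⟩]
        exact Nat.find_spec hj
      calc (2⁻¹ : ℝ≥0∞) ^ (k + 1) = volume (Ioo ((2⁻¹ : ℝ) ^ (k + 1)) (2⁻¹ ^ k)) := by
            rw [Real.volume_Ioo, pow_succ (2⁻¹ : ℝ), show (2⁻¹ : ℝ) ^ k - 2⁻¹ ^ k * 2⁻¹ =
              2⁻¹ ^ (k + 1) by ring, ENNReal.ofReal_pow (by norm_num),
              ENNReal.ofReal_inv_of_pos (by norm_num), ENNReal.ofReal_ofNat]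
        _ ≤ volume ({t | ρ < F (dyadicIndex t)} ∩ Ioo 0 1) := measure_mono hsub
        _ = vol01 {t | ρ < F (dyadicIndex t)} :=
            (Measure.restrict_apply' measurableSet_Ioo).symm
    calc 2 * vol01 {t | ρ < dyadicStep F t} ≤ 2 * 2⁻¹ ^ k := by gcongr
      _ = 4 * 2⁻¹ ^ (k + 1) := by
          rw [pow_succ, show (4 : ℝ≥0∞) = 2 * 2 by norm_num]
          calc (2 : ℝ≥0∞) * 2⁻¹ ^ k = 2 * 2⁻¹ ^ k * (2 * 2⁻¹) := by
                rw [ENNReal.mul_inv_cancel (by simp) (by simp), mul_one]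
            _ = _ := by ring
      _ ≤ _ := by push_cast; gcongr
  · push Not at hj
    have : {t | ρ < dyadicStep F t} = ∅ := by
      ext t
      simp only [mem_ofPred_eq, mem_empty_iff_false, iff_false, not_lt]
      exact iSup_le fun j => indicator_le' (fun _ _ => hj j) (fun _ _ => zero_le) t
    simp [this]

lemma sum_le_S1_dyadicStep {n m : ℕ} (hmn : m < n) {d : ℝ} (hd : 0 < d) (F : ℕ → ℝ≥0∞) {k : ℕ}
    {t : ℝ} (ht0 : 0 < t) (ht : t < ((2⁻¹ : ℝ) ^ (d / n)) ^ (k + 1)) :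
    ∑ j ∈ Finset.range (k + 1), halvingRatio n ^ (m * j) * F j ≤
      2 * S1 n m d (dyadicStep F) t := by
  have hn0 : (0 : ℝ) < n := by exact_mod_cast (by omega : 0 < n)
  have hmn' : (m : ℝ) / n - 1 ≤ 0 := by
    rw [sub_nonpos, div_le_one hn0]; exact_mod_cast hmn.le
  have htk : t ^ ((n : ℝ) / d) < 2⁻¹ ^ (k + 1) := by
    refine (Real.rpow_lt_rpow ht0.le ht (div_pos hn0 hd)).trans_eq ?_
    rw [← Real.rpow_natCast, ← Real.rpow_mul (by positivity), ← Real.rpow_mul (by norm_num),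
      show d / n * (((k + 1 : ℕ) : ℝ) * (n / d)) = ((k + 1 : ℕ) : ℝ) by field_simp,
      Real.rpow_natCast]
  set J : ℕ → Set ℝ := fun j => Ioo ((2⁻¹ : ℝ) ^ (j + 1)) (2⁻¹ ^ j) with hJ
  have hdisj : Pairwise (Function.onFun Disjoint J) := by
    have : ∀ i j, i < j → Disjoint (J i) (J j) := fun i j hij => by
      rw [Set.disjoint_left]
      intro s hs hs'
      have : (2⁻¹ : ℝ) ^ j ≤ 2⁻¹ ^ (i + 1) :=
        pow_le_pow_of_le_one (by norm_num) (by norm_num) hij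
      exact absurd (hs.1.trans hs'.2) (not_lt.2 this)
    intro i j hij
    rcases lt_or_gt_of_ne hij with h | h
    · exact this i j h
    · exact (this j i h).symm
  have hone : ∀ j, halvingRatio n ^ (m * j) * F j ≤
      2 * ∫⁻ s in J j, ENNReal.ofReal (s ^ ((m : ℝ) / n - 1)) * dyadicStep F s := fun j => by
    have hval : ENNReal.ofReal (((2⁻¹ : ℝ) ^ j) ^ ((m : ℝ) / n - 1)) =
        halvingRatio n ^ (m * j) * 2 ^ j := by
      rw [Real.rpow_sub (by positivity), Real.rpow_one, div_eq_mul_inv,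
        ENNReal.ofReal_mul (by positivity), ← inv_pow, inv_inv, ENNReal.ofReal_pow (by norm_num),
        ENNReal.ofReal_ofNat]
      congr 1
      rw [halvingRatio, ← ENNReal.rpow_natCast, ← ENNReal.rpow_mul, ← Real.rpow_natCast,
        ← Real.rpow_mul (by norm_num), ← ENNReal.ofReal_rpow_of_pos (by norm_num),
        ENNReal.ofReal_inv_of_pos (by norm_num), ENNReal.ofReal_ofNat]
      congr 1
      push_cast
      ring
    have hint : ∫⁻ _ in J j, halvingRatio n ^ (m * j) * 2 ^ j * F j ≤
        ∫⁻ s in J j, ENNReal.ofReal (s ^ ((m : ℝ) / n - 1)) * dyadicStep F s := by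
      refine setLIntegral_mono' measurableSet_Ioo fun s hs => ?_
      rw [← hval]
      refine mul_le_mul' (ENNReal.ofReal_le_ofReal ?_) (le_dyadicStep F hs.2)
      exact Real.rpow_le_rpow_of_nonpos (lt_trans (by positivity) hs.1) hs.2.le hmn'
    rw [setLIntegral_const, Real.volume_Ioo, pow_succ, show (2⁻¹ : ℝ) ^ j - 2⁻¹ ^ j * 2⁻¹ =
      2⁻¹ ^ (j + 1) by ring, ENNReal.ofReal_pow (by norm_num),
      ENNReal.ofReal_inv_of_pos (by norm_num), ENNReal.ofReal_ofNat] at hint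
    calc halvingRatio n ^ (m * j) * F j
        = (2 * 2⁻¹) ^ (j + 1) * (halvingRatio n ^ (m * j) * F j) := by
          rw [ENNReal.mul_inv_cancel (by simp) (by simp), one_pow, one_mul]
      _ = 2 * (halvingRatio n ^ (m * j) * 2 ^ j * F j * 2⁻¹ ^ (j + 1)) := by
          rw [mul_pow, pow_succ (2 : ℝ≥0∞)]; ring
      _ ≤ _ := by gcongr
  calc ∑ j ∈ Finset.range (k + 1), halvingRatio n ^ (m * j) * F j
      ≤ ∑ j ∈ Finset.range (k + 1),
        2 * ∫⁻ s in J j, ENNReal.ofReal (s ^ ((m : ℝ) / n - 1)) * dyadicStep F s :=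
        Finset.sum_le_sum fun j _ => hone j
    _ = 2 * ∫⁻ s in ⋃ j ∈ Finset.range (k + 1), J j,
          ENNReal.ofReal (s ^ ((m : ℝ) / n - 1)) * dyadicStep F s := by
        rw [lintegral_biUnion_finset (fun i _ j _ hij => hdisj hij) fun _ _ => measurableSet_Ioo,
          Finset.mul_sum]
    _ ≤ _ := by
        rw [S1]
        refine mul_le_mul_right (lintegral_mono_set fun s hs => ?_) _
        simp only [mem_iUnion, Finset.mem_range] at hs
        obtain ⟨j, hj, hs⟩ := hs
        exact ⟨htk.trans_le ((pow_le_pow_of_le_one (by norm_num) (by norm_num)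
          (by omega)).trans hs.1.le), hs.2.trans_le (pow_le_one₀ (by norm_num) (by norm_num))⟩

lemma vol01_lt_distRearr_le_of_nested {α : Type*} [MeasurableSpace α] {μ : Measure α} {a : ℝ}
    (ha : 0 < a) {τ : ℝ} (hτ0 : 0 < τ) (hτ1 : τ ≤ 1) {D : ℕ → Set α} (hD : Antitone D)
    {C C' : ℝ≥0∞} (hμD : ∀ k, μ (D k) ≤ C' * ENNReal.ofReal (τ ^ k))
    {v : α → ℝ≥0∞} {c : ℕ → ℝ≥0∞} (hv : ∀ x, v x ≤ C * ∑' j, c j * (D j).indicator 1 x)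
    {G : ℝ → ℝ≥0∞}
    (hG : ∀ k t, 0 < t → t < τ ^ (k + 1) → C * ∑ j ∈ Finset.range (k + 1), c j ≤ G t)
    {M : ℝ≥0∞} (hM : 2 * (C' / ENNReal.ofReal a) ≤ M * ENNReal.ofReal τ) (ρ : ℝ≥0∞) :
    2 * vol01 {t | ρ < distRearr μ v (a * t)} ≤ M * vol01 {t | ρ < G t} := by
  classical
  rw [vol01_lt_distRearr ha]
  rcases eq_empty_or_nonempty {x | ρ < v x} with he | ⟨x₁, hx₁⟩
  · simp [he]
  have hex : ∃ i, ρ < C * ∑ j ∈ Finset.range i, c j := by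
    have h1 : ρ < C * ∑' j, c j := by
      refine (mem_ofPred.1 hx₁).trans_le ((hv x₁).trans (mul_le_mul_right ?_ _))
      exact ENNReal.tsum_le_tsum fun j =>
        mul_le_of_le_one_right' (indicator_le_self' (fun _ _ => zero_le) x₁)
    rw [ENNReal.tsum_eq_iSup_nat, ENNReal.mul_iSup] at h1
    exact lt_iSup_iff.1 h1
  obtain ⟨k, hk⟩ : ∃ k, Nat.find hex = k + 1 := by
    refine Nat.exists_eq_succ_of_ne_zero fun h0 => ?_
    have := Nat.find_spec hex
    simp [h0] at this
  have hk1 : ρ < C * ∑ j ∈ Finset.range (k + 1), c j := hk ▸ Nat.find_spec hex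
  have hk2 : C * ∑ j ∈ Finset.range k, c j ≤ ρ := not_lt.1 (Nat.find_min hex (by omega))
  have hsub : {x | ρ < v x} ⊆ D k := by
    intro x hx
    by_contra hxD
    refine absurd (mem_ofPred.1 hx) (not_lt.2 ((hv x).trans (le_trans ?_ hk2)))
    refine mul_le_mul_right ?_ _
    rw [tsum_eq_sum (s := Finset.range k)]
    · exact Finset.sum_le_sum fun j _ =>
        mul_le_of_le_one_right' (indicator_le_self' (fun _ _ => zero_le) x)
    · intro j hj
      rw [indicator_of_notMem (fun hxj => hxD (hD (by simpa using hj) hxj)), mul_zero]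
  have hG' : ENNReal.ofReal (τ ^ (k + 1)) ≤ vol01 {t | ρ < G t} := by
    rw [← vol01_Iio (pow_le_one₀ hτ0.le hτ1), vol01_apply, vol01_apply]
    exact measure_mono fun t ht => ⟨hk1.trans_le (hG k t ht.2.1 ht.1), ht.2⟩
  calc 2 * min 1 (μ {x | ρ < v x} / ENNReal.ofReal a)
      ≤ 2 * (C' * ENNReal.ofReal (τ ^ k) / ENNReal.ofReal a) := by
        refine mul_le_mul_right ((min_le_right _ _).trans ?_) _
        exact ENNReal.div_le_div_right ((measure_mono hsub).trans (hμD k)) _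
    _ = 2 * (C' / ENNReal.ofReal a) * ENNReal.ofReal (τ ^ k) := by
        simp only [div_eq_mul_inv]; ring
    _ ≤ M * ENNReal.ofReal τ * ENNReal.ofReal (τ ^ k) := by gcongr
    _ = M * ENNReal.ofReal (τ ^ (k + 1)) := by
        rw [mul_assoc, ← ENNReal.ofReal_mul hτ0.le, pow_succ']
    _ ≤ _ := by gcongr

/-- **Improved reduction principle for `d`-Frostman measures with a radially decreasing
density (`0 < d < n-m`):** the single Hardy-type inequality for `S₁` suffices for the
Sobolev trace inequality. -/
theorem reduction_principle_radial (n m : ℕ) (hn : 2 ≤ n) (hm : 1 ≤ m) (hmn : m < n)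
    (d : ℝ) (hd0 : 0 < d) (hd : d < (n : ℝ) - m)
    (Ω : Set (EuclideanSpace ℝ (Fin n))) (hΩ : IsOpen Ω) (hΩvol : volume Ω < ⊤)
    (NX NY : (ℝ → ℝ≥0∞) → ℝ≥0∞) (hX : IsRINorm NX) (hY : IsRINorm NY)
    (x₀ : EuclideanSpace ℝ (Fin n)) (hx₀ : x₀ ∈ Ω)
    (g : ℝ → ℝ) (hgm : Measurable g) (hg : AntitoneOn g (Set.Ioi 0))
    (hgnn : ∀ t : ℝ, 0 < t → 0 ≤ g t)
    (μ : Measure (EuclideanSpace ℝ (Fin n)))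
    (hμdef : μ = (volume.restrict Ω).withDensity fun x => ENNReal.ofReal (g ‖x - x₀‖))
    (hfin : IsFiniteMeasure μ)
    (hFrostman : ∃ A : ℝ, ∀ (x : EuclideanSpace ℝ (Fin n)) (r : ℝ), 0 < r →
        μ (Metric.ball x r ∩ Ω) ≤ ENNReal.ofReal (A * r ^ d))
    (C₁ : ℝ)
    (hHardy : ∀ f : ℝ → ℝ≥0∞, Measurable f → AntitoneOn f (Set.Ioo 0 1) →
        NY (S1 n m d f) ≤ ENNReal.ofReal C₁ * NX f) :
    ∃ C₂ : ℝ, ∀ u : EuclideanSpace ℝ (Fin n) → ℝ,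
      ContDiff ℝ (⊤ : ℕ∞) u → HasCompactSupport u → tsupport u ⊆ Ω →
      NY (fun t => rearr μ u ((μ Ω).toReal * t)) ≤
        ENNReal.ofReal C₂ *
          NX (fun t => rearr (volume.restrict Ω) (fun x => ‖iteratedFDeriv ℝ m u x‖)
            ((volume Ω).toReal * t)) := by
  obtain ⟨A, hA⟩ := hFrostman
  have hn0 : (0 : ℝ) < n := by exact_mod_cast (by omega : 0 < n)
  have hμΩc : μ Ωᶜ = 0 := by
    rw [hμdef, withDensity_apply _ hΩ.measurableSet.compl,
      Measure.restrict_restrict hΩ.measurableSet.compl, compl_inter_self, Measure.restrict_empty,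
      lintegral_zero_measure]
  by_cases hμ0 : μ Ω = 0
  · have hμz : μ = 0 := by
      rw [← Measure.measure_univ_eq_zero, ← union_compl_self Ω]
      exact measure_union_null hμ0 hμΩc
    refine ⟨0, fun u _ _ _ => ?_⟩
    have : NY (fun t => rearr μ u ((μ Ω).toReal * t)) = 0 :=
      (hY.eq_zero_iff _).2 (.of_forall fun t => by simp [rearr, hμz])
    rw [this]
    exact zero_le
  have ha : 0 < (μ Ω).toReal := ENNReal.toReal_pos hμ0 (measure_ne_top μ Ω)
  have hV : 0 < (volume Ω).toReal :=
    ENNReal.toReal_pos (hΩ.measure_pos volume ⟨x₀, hx₀⟩).ne' hΩvol.ne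
  have hVeq : ENNReal.ofReal (volume Ω).toReal = volume Ω := ENNReal.ofReal_toReal hΩvol.ne
  obtain ⟨m', rfl⟩ : ∃ m', m = m' + 1 := ⟨m - 1, by omega⟩
  obtain ⟨C, hC⟩ := exists_kernelBound_iteratedFDeriv hn hV m' 0
  obtain ⟨C', hC'⟩ := exists_radial_measure_le hn hΩ hx₀ hg hμdef (hA x₀) C
  obtain ⟨K, hK⟩ := exists_kernel_average_le hV C
  set τ : ℝ := (2⁻¹ : ℝ) ^ (d / n) with hτ
  have hτ0 : 0 < τ := Real.rpow_pos_of_pos (by norm_num) _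
  have hτ1 : τ ≤ 1 := Real.rpow_le_one (by norm_num) (by norm_num) (by positivity)
  obtain ⟨M, hM0, hM⟩ : ∃ M : ℕ, M ≠ 0 ∧
      2 * ((C' : ℝ≥0∞) / ENNReal.ofReal (μ Ω).toReal) ≤ M * ENNReal.ofReal τ := by
    obtain ⟨M, hM⟩ := ENNReal.exists_nat_gt
      (r := 2 * ((C' : ℝ≥0∞) / ENNReal.ofReal (μ Ω).toReal) / ENNReal.ofReal τ)
      (ENNReal.div_ne_top (ENNReal.mul_ne_top (by simp) (ENNReal.div_ne_top (by simp)
        (ENNReal.ofReal_pos.2 ha).ne')) (ENNReal.ofReal_pos.2 hτ0).ne')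
    refine ⟨M + 1, by omega, ?_⟩
    rw [← ENNReal.div_le_iff (by simpa using hτ0) (by simp)]
    exact hM.le.trans (by push_cast; exact le_self_add)
  refine ⟨((M * (2 * C) * C₁.toNNReal * 4 * K : ℝ≥0) : ℝ), fun u hu huc huΩ => ?_⟩
  rw [ENNReal.ofReal_coe_nnreal]
  obtain ⟨D, ω, hDm, hDa, hωm, hDv, hωs, hωi, hv⟩ :=
    hC hu huc ((measure_mono huΩ).trans_eq hVeq.symm)
  rw [zero_add] at hv
  set h : EuclideanSpace ℝ (Fin n) → ℝ≥0∞ := fun x => ‖iteratedFDeriv ℝ (m' + 1) u x‖ₑ with hh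
  have hcont : Continuous (iteratedFDeriv ℝ (m' + 1) u) :=
    hu.continuous_iteratedFDeriv (by exact_mod_cast le_top)
  have hhm : Measurable h := hcont.enorm.measurable
  obtain ⟨B, hB⟩ : ∃ B : ℝ≥0, ∀ x, h x ≤ B := by
    obtain ⟨B, hB⟩ := hcont.bounded_above_of_compact_support (huc.iteratedFDeriv (m' + 1))
    refine ⟨B.toNNReal, fun x => ?_⟩
    simp only [hh, ← ofReal_norm]
    exact ENNReal.ofReal_le_ofReal (hB x)
  have hh0 : ∀ x, x ∉ Ω → h x = 0 := fun x hx => by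
    have : x ∉ Function.support (iteratedFDeriv ℝ (m' + 1) u) :=
      fun hx' => hx (huΩ (support_iteratedFDeriv_subset (m' + 1) hx'))
    rw [hh]
    simpa using this
  have hint : ∀ j, ∫⁻ y, h y * ω j y = ∫⁻ y in Ω, h y * ω j y := fun j =>
    (setLIntegral_eq_of_support_subset fun x hx => by
      by_contra hxΩ
      exact hx (by simp [hh0 x hxΩ])).symm
  set F : ℕ → ℝ≥0∞ := fun j => 2 ^ j * ∫⁻ y, h y * ω j y with hF
  have hdist := fun ρ => vol01_lt_distRearr_le_of_nested (μ := μ) ha hτ0 hτ1 hDa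
    (C := C) (v := fun x => ENNReal.ofReal |u x|)
    (c := fun j => halvingRatio n ^ ((m' + 1) * j) * F j)
    (G := fun t => ((2 * C : ℝ≥0) : ℝ≥0∞) * S1 n (m' + 1) d (dyadicStep F) t)
    (fun k => hC' k _ (hDm k) (hDv k))
    (fun x => by
      have := hv x
      simp only [← ofReal_norm, norm_iteratedFDeriv_zero, Real.norm_eq_abs] at this
      simpa only [hF, mul_assoc] using this)
    (fun k t ht0 ht => by
      refine (mul_le_mul_right (sum_le_S1_dyadicStep hmn hd0 F ht0 ht) _).trans_eq ?_
      push_cast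
      ring) hM ρ
  calc NY (fun t => rearr μ u ((μ Ω).toReal * t))
      ≤ M * NY (fun t => ((2 * C : ℝ≥0) : ℝ≥0∞) * S1 n (m' + 1) d (dyadicStep F) t) :=
        hY.le_mul_of_dist_le_mul M hM0 hdist
    _ = M * (((2 * C : ℝ≥0) : ℝ≥0∞) * NY (S1 n (m' + 1) d (dyadicStep F))) := by rw [hY.smul]
    _ ≤ M * (((2 * C : ℝ≥0) : ℝ≥0∞) * (ENNReal.ofReal C₁ * (4 * (K *
          NX fun t => distRearr (volume.restrict Ω) h ((volume Ω).toReal * t))))) := by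
        gcongr
        refine (hHardy _ (measurable_dyadicStep F) ((antitone_dyadicStep F).antitoneOn _)).trans ?_
        gcongr
        refine (hX.dyadicStep_le F).trans ?_
        gcongr
        simp only [hF, hint]
        refine hK hX (volume.restrict Ω) ?_ hhm ENNReal.coe_ne_top hB ω hωm hωs fun k =>
          (lintegral_mono' Measure.restrict_le_self le_rfl).trans (hωi k)
        rw [Measure.restrict_apply_univ, hVeq]
    _ = _ := by
        have : (fun x => ENNReal.ofReal |‖iteratedFDeriv ℝ (m' + 1) u x‖|) = h := by
          funext x
          rw [abs_norm, ofReal_norm]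
        simp only [rearr, distRearr, ← this]
        push_cast
        simp only [ENNReal.ofReal]
        ring
end

section
/- Let n ≥ 1, d ∈ (0, n], x₀ ∈ ℝⁿ, and let g : (0,∞) → [0,∞) be a non-increasing measurable function. Suppose A ≥ 0 is such that ∫_{B_r(x₀)} g(|x−x₀|) dx ≤ A r^d for every r > 0. Then for every Lebesgue-measurable set E ⊆ ℝⁿ: ∫_E g(|x−x₀|) dx ≤ A (|E|/ω_n)^{d/n}, where |E| is the Lebesgue measure of E and ω_n is the Lebesgue measure of the unit ball in ℝⁿ. (Consequently, a measure with radially decreasing density satisfying a d-Frostman bound on balls centered at x₀ satisfies μ(E) ≲ |E|^{d/n} for all Borel sets E.) -/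
open MeasureTheory Set
open scoped ENNReal NNReal

/-- **Bathtub principle**: among sets of a given finite measure, the integral of `f` is largest over
a set outside of which `f` is at most `c` and inside of which `f` is at least `c`. -/
theorem setLIntegral_le_of_measure_eq {α : Type*} [MeasurableSpace α] {μ : Measure α}
    {f : α → ℝ≥0∞} {c : ℝ≥0∞} {s t : Set α} (hs : MeasurableSet s) (ht : MeasurableSet t)
    (hst : μ s = μ t) (hfin : μ s ≠ ∞) (hle : ∀ x ∈ s \ t, f x ≤ c)
    (hge : ∀ᵐ x ∂μ, x ∈ t \ s → c ≤ f x) :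
    ∫⁻ x in s, f x ∂μ ≤ ∫⁻ x in t, f x ∂μ := by
  have hdiff : μ (s \ t) = μ (t \ s) :=
    measure_sdiff_symm hs.nullMeasurableSet ht.nullMeasurableSet hst
      (measure_ne_top_of_subset inter_subset_left hfin)
  rw [← lintegral_inter_add_sdiff f s ht, ← lintegral_inter_add_sdiff f t hs, inter_comm t s]
  gcongr _ + ?_
  calc ∫⁻ x in s \ t, f x ∂μ ≤ ∫⁻ _ in s \ t, c ∂μ := setLIntegral_mono measurable_const hle
    _ = ∫⁻ _ in t \ s, c ∂μ := by simp only [setLIntegral_const, hdiff]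
    _ ≤ ∫⁻ x in t \ s, f x ∂μ := setLIntegral_mono_ae' (ht.diff hs) hge

/-- A function whose integral over every ball centered at `x₀` vanishes has integral zero. -/
theorem lintegral_eq_zero_of_forall_ball {α : Type*} [PseudoMetricSpace α] [MeasurableSpace α]
    {μ : Measure α} {f : α → ℝ≥0∞} (x₀ : α)
    (h : ∀ r : ℝ, 0 < r → ∫⁻ x in Metric.ball x₀ r, f x ∂μ = 0) : ∫⁻ x, f x ∂μ = 0 := by
  rw [← setLIntegral_univ, ← Metric.iUnion_ball_nat_succ x₀]
  exact le_antisymm ((lintegral_iUnion_le _ _).trans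
    (by simp [h _ (Nat.cast_add_one_pos _)])) zero_le

/-- **A radially decreasing density with a `d`-Frostman bound on balls centered at `x₀`
satisfies `μ(E) ≤ A (|E|/ω_n)^{d/n}` for every measurable set `E`.** -/
theorem radial_density_set_bound (n : ℕ) (hn : 1 ≤ n) (d : ℝ) (hd0 : 0 < d) (hdn : d ≤ n)
    (x₀ : EuclideanSpace ℝ (Fin n))
    (g : ℝ → ℝ) (hgm : Measurable g) (hg : AntitoneOn g (Set.Ioi 0))
    (hgnn : ∀ t : ℝ, 0 < t → 0 ≤ g t)
    (A : ℝ) (hA : 0 ≤ A)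
    (hball : ∀ r : ℝ, 0 < r →
        (∫⁻ x in Metric.ball x₀ r, ENNReal.ofReal (g ‖x - x₀‖)) ≤
          ENNReal.ofReal (A * r ^ d)) :
    ∀ E : Set (EuclideanSpace ℝ (Fin n)), MeasurableSet E →
      (∫⁻ x in E, ENNReal.ofReal (g ‖x - x₀‖)) ≤
        ENNReal.ofReal A *
          (volume E / volume (Metric.ball (0 : EuclideanSpace ℝ (Fin n)) 1)) ^
            (d / (n : ℝ)) := by
  intro E hE
  have hn0 : (0 : ℝ) < n := by exact_mod_cast hn
  have : Nonempty (Fin n) := ⟨⟨0, hn⟩⟩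
  set ω := volume (Metric.ball (0 : EuclideanSpace ℝ (Fin n)) 1)
  have hω0 : ω ≠ 0 := (Metric.measure_ball_pos _ _ one_pos).ne'
  have hω1 : ω ≠ ∞ := measure_ball_lt_top.ne
  rcases eq_or_ne (volume E) 0 with hE0 | hE0
  · simp [setLIntegral_measure_zero _ _ hE0]
  rcases eq_or_ne (volume E) ∞ with hE1 | hE1
  · rcases hA.eq_or_lt with rfl | hA
    · have h0 : ∫⁻ x, ENNReal.ofReal (g ‖x - x₀‖) = 0 :=
        lintegral_eq_zero_of_forall_ball x₀ fun r hr ↦ by simpa using hball r hr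
      exact (setLIntegral_le_lintegral _ _).trans (by simp [h0])
    · rw [hE1, ENNReal.top_div_of_ne_top hω1, ENNReal.top_rpow_of_pos (by positivity),
        ENNReal.mul_top (by simpa using hA)]
      exact le_top
  have hq0 : volume E / ω ≠ 0 := ENNReal.div_ne_zero.2 ⟨hE0, hω1⟩
  have hq1 : volume E / ω ≠ ∞ := ENNReal.div_ne_top hE1 hω0
  set q := (volume E / ω).toReal
  have hqpos : 0 < q := ENNReal.toReal_pos hq0 hq1
  have hqE : volume E / ω = ENNReal.ofReal q := (ENNReal.ofReal_toReal hq1).symm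
  set r := q ^ (1 / (n : ℝ)) with hr
  have hrpos : 0 < r := Real.rpow_pos_of_pos hqpos _
  have hrn : r ^ n = q := by
    rw [hr, ← Real.rpow_natCast, ← Real.rpow_mul hqpos.le, one_div_mul_cancel hn0.ne',
      Real.rpow_one]
  have hrd : r ^ d = q ^ (d / (n : ℝ)) := by
    rw [hr, ← Real.rpow_mul hqpos.le, one_div_mul_eq_div]
  have hvol : volume E = volume (Metric.ball x₀ r) := by
    rw [Measure.addHaar_ball_of_pos _ _ hrpos, finrank_euclideanSpace_fin, hrn, ← hqE,
      ENNReal.div_mul_cancel hω0 hω1]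
  calc ∫⁻ x in E, ENNReal.ofReal (g ‖x - x₀‖)
      ≤ ∫⁻ x in Metric.ball x₀ r, ENNReal.ofReal (g ‖x - x₀‖) := by
        refine setLIntegral_le_of_measure_eq (c := ENNReal.ofReal (g r)) hE
          Metric.isOpen_ball.measurableSet hvol hE1 (fun x hx ↦ ?_) ?_
        · have hx' : r ≤ ‖x - x₀‖ := by simpa [dist_eq_norm] using hx.2
          exact ENNReal.ofReal_le_ofReal (hg hrpos (hrpos.trans_le hx') hx')
        · filter_upwards [Measure.ae_ne volume x₀] with x hne hx
          have hx' : ‖x - x₀‖ < r := by simpa [dist_eq_norm] using hx.1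
          exact ENNReal.ofReal_le_ofReal (hg (norm_pos_iff.2 (sub_ne_zero.2 hne)) hrpos hx'.le)
    _ ≤ ENNReal.ofReal (A * r ^ d) := hball r hrpos
    _ = ENNReal.ofReal A * (volume E / ω) ^ (d / (n : ℝ)) := by
        rw [hqE, ENNReal.ofReal_rpow_of_pos hqpos, ENNReal.ofReal_mul hA, hrd]
end

section
/- For a nonnegative measurable function f on (0,1) define S₁f(t) = ∫_{t^{n/d}}^1 f(s) s^{−1+m/n} ds, t ∈ (0,1), where n ≥ 2 and m ∈ ℕ with m < n. Then: (a) if either d ∈ [n−m, n] and p ∈ [1, n/m), or d ∈ (0, n−m) and p ∈ ((n−d)/m, n/m), there is a constant C = C(n,m,d,p) with ( ∫₀¹ ( t^{(n−mp)/(dp) − 1/p} · S₁f(t) )^p dt )^{1/p} ≤ C ( ∫₀¹ f(s)^p ds )^{1/p}, i.e. S₁ : L^p(0,1) → L^{dp/(n−mp),p}(0,1) is bounded; (b) for p = n/m and any d ∈ (0,n], ( ∫₀¹ ( t^{−m/n} (log(e/t))^{−1} S₁f(t) )^{n/m} dt )^{m/n} ≤ C ( ∫₀¹ f^{n/m} )^{m/n},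 i.e. S₁ : L^{n/m}(0,1) → L^{∞,n/m;−1}(0,1) is bounded; (c) for p ∈ (n/m, ∞] and any d ∈ (0,n], sup_{t ∈ (0,1)} S₁f(t) ≤ C ‖f‖_{L^p(0,1)}. -/
open MeasureTheory Set
open scoped ENNReal NNReal

/-- A function with nonnegative derivative `g` on an open interval and values in `[A, B]` there
has `∫⁻ g ≤ B - A`. -/
theorem lintegral_Ioo_deriv_le {F g : ℝ → ℝ} {a b A B : ℝ}
    (hF : ∀ x ∈ Ioo a b, HasDerivAt F (g x) x) (hg : ∀ x ∈ Ioo a b, 0 ≤ g x)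
    (hAB : ∀ x ∈ Ioo a b, F x ∈ Icc A B) :
    ∫⁻ x in Ioo a b, ENNReal.ofReal (g x) ≤ ENNReal.ofReal (B - A) := by
  have hmono : MonotoneOn F (Ioo a b) := by
    refine monotoneOn_of_hasDerivWithinAt_nonneg (f' := g) (convex_Ioo a b)
      (fun x hx => (hF x hx).continuousAt.continuousWithinAt) ?_ ?_
    · intro x hx
      rw [interior_Ioo] at hx ⊢
      exact (hF x hx).hasDerivWithinAt
    · intro x hx
      rw [interior_Ioo] at hx
      exact hg x hx
  rw [lintegral_deriv_eq_volume_image_of_monotoneOn measurableSet_Ioo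
    (fun x hx => (hF x hx).hasDerivWithinAt) hmono, ← Real.volume_Icc]
  exact measure_mono (image_subset_iff.2 hAB)

theorem lintegral_Ioo_zero_rpow_le {b η : ℝ} (hη : 0 < η) :
    ∫⁻ t in Ioo 0 b, ENNReal.ofReal (t ^ (η - 1)) ≤ ENNReal.ofReal (b ^ η / η) := by
  have h := lintegral_Ioo_deriv_le (F := fun t => t ^ η / η) (g := fun t => t ^ (η - 1))
    (a := 0) (b := b) (A := 0) (B := b ^ η / η) ?_ ?_ ?_
  · simpa using h
  · intro x hx
    have := (Real.hasDerivAt_rpow_const (p := η) (Or.inl hx.1.ne')).div_const η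
    refine this.congr_deriv ?_
    field_simp
  · intro x hx
    have := hx.1
    positivity
  · intro x hx
    have h0 := hx.1
    refine ⟨by positivity, ?_⟩
    have := hx.2.le
    gcongr

theorem lintegral_Ioo_one_rpow_le {r δ : ℝ} (hr : 0 < r) (hδ : 0 < δ) :
    ∫⁻ s in Ioo r 1, ENNReal.ofReal (s ^ (-1 - δ)) ≤ ENNReal.ofReal (r ^ (-δ) / δ) := by
  have h := lintegral_Ioo_deriv_le (F := fun s => -(s ^ (-δ) / δ)) (g := fun s => s ^ (-1 - δ))
    (a := r) (b := 1) (A := -(r ^ (-δ) / δ)) (B := 0) ?_ ?_ ?_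
  · simpa using h
  · intro x hx
    have hx0 : 0 < x := hr.trans hx.1
    have := ((Real.hasDerivAt_rpow_const (p := -δ) (Or.inl hx0.ne')).div_const δ).neg
    refine this.congr_deriv ?_
    rw [show -1 - δ = -δ - 1 by ring]
    field_simp
  · intro x hx
    have hx0 : 0 < x := hr.trans hx.1
    positivity
  · intro x hx
    have hx0 : 0 < x := hr.trans hx.1
    refine ⟨neg_le_neg ?_, neg_nonpos.2 (by positivity)⟩
    exact div_le_div_of_nonneg_right
      (Real.rpow_le_rpow_of_nonpos hr hx.1.le (by linarith)) hδ.le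

/-- Weighted Jensen inequality for `∫⁻ k f`, with an auxiliary weight `ρ`. -/
theorem lintegral_mul_rpow_le {α : Type*} [MeasurableSpace α] {μ : Measure α} {p : ℝ} (hp : 1 ≤ p)
    {k ρ : α → ℝ} {f : α → ℝ≥0∞} (hk : Measurable k) (hρ : Measurable ρ) (hf : Measurable f)
    (hk0 : ∀ᵐ x ∂μ, 0 < k x) (hρ0 : ∀ᵐ x ∂μ, 0 < ρ x) :
    (∫⁻ x, ENNReal.ofReal (k x) * f x ∂μ) ^ p ≤
      (∫⁻ x, ENNReal.ofReal (ρ x) ∂μ) ^ (p - 1) *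
        ∫⁻ x, ENNReal.ofReal (k x ^ p / ρ x ^ (p - 1)) * f x ^ p ∂μ := by
  have hp0 : 0 < p := by linarith
  have hle : 1 / p ≤ 1 := by rw [div_le_one hp0]; exact hp
  have key := ENNReal.lintegral_mul_norm_pow_le (μ := μ) (f := fun x => ENNReal.ofReal (ρ x))
    (g := fun x => ENNReal.ofReal (k x ^ p / ρ x ^ (p - 1)) * f x ^ p) (p := 1 - 1 / p)
    (q := 1 / p) (by fun_prop) (by fun_prop) (by linarith) (by positivity) (by ring)
  have heq : ∫⁻ x, ENNReal.ofReal (k x) * f x ∂μ =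
      ∫⁻ x, ENNReal.ofReal (ρ x) ^ (1 - 1 / p) *
        (ENNReal.ofReal (k x ^ p / ρ x ^ (p - 1)) * f x ^ p) ^ (1 / p) ∂μ := by
    refine lintegral_congr_ae ?_
    filter_upwards [hk0, hρ0] with x hkx hρx
    rw [ENNReal.mul_rpow_of_nonneg _ _ (by positivity), ← ENNReal.rpow_mul,
      mul_one_div_cancel hp0.ne', ENNReal.rpow_one, ← mul_assoc,
      ENNReal.ofReal_rpow_of_pos hρx, ENNReal.ofReal_rpow_of_pos (by positivity),
      ← ENNReal.ofReal_mul (by positivity)]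
    congr 2
    rw [Real.div_rpow (by positivity) (by positivity), ← Real.rpow_mul hkx.le,
      ← Real.rpow_mul hρx.le, mul_one_div_cancel hp0.ne', Real.rpow_one,
      show (p - 1) * (1 / p) = 1 - 1 / p by field_simp]
    field_simp
  rw [heq]
  refine (ENNReal.rpow_le_rpow key hp0.le).trans_eq ?_
  rw [ENNReal.mul_rpow_of_nonneg _ _ hp0.le, ← ENNReal.rpow_mul, ← ENNReal.rpow_mul,
    one_div_mul_cancel hp0.ne', ENNReal.rpow_one,
    show (1 - 1 / p) * p = p - 1 by field_simp]

/-- A Schur-type test for weighted `L^p` boundedness of a Hardy-type operator. -/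
theorem lintegral_hardy_rpow_le {p κ K : ℝ} (hp : 1 ≤ p) (hκ : 0 < κ) (hK : 0 ≤ K)
    {k ρ W M : ℝ → ℝ} {f : ℝ → ℝ≥0∞}
    (hk : Measurable k) (hρ : Measurable ρ) (hW : Measurable W) (hM : Measurable M)
    (hf : Measurable f)
    (hk0 : ∀ s ∈ Ioo (0 : ℝ) 1, 0 < k s) (hρ0 : ∀ s ∈ Ioo (0 : ℝ) 1, 0 < ρ s)
    (hW0 : ∀ s ∈ Ioo (0 : ℝ) 1, 0 < W s) (hM0 : ∀ s ∈ Ioo (0 : ℝ) 1, 0 < M s)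
    (hρM : ∀ t ∈ Ioo (0 : ℝ) 1, ∫⁻ s in Ioo (t ^ κ) 1, ENNReal.ofReal (ρ s) ≤
      ENNReal.ofReal (M t))
    (hWM : ∀ s ∈ Ioo (0 : ℝ) 1,
      ∫⁻ t in Ioo 0 (s ^ κ⁻¹), ENNReal.ofReal (W t ^ p * M t ^ (p - 1)) ≤
        ENNReal.ofReal (K * (ρ s ^ (p - 1) / k s ^ p))) :
    ∫⁻ t in Ioo (0 : ℝ) 1,
        (ENNReal.ofReal (W t) * ∫⁻ s in Ioo (t ^ κ) 1, ENNReal.ofReal (k s) * f s) ^ p ≤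
      ENNReal.ofReal K * ∫⁻ s in Ioo (0 : ℝ) 1, f s ^ p := by
  have hp0 : 0 < p := by linarith
  set G : ℝ → ℝ≥0∞ := fun s => ENNReal.ofReal (k s ^ p / ρ s ^ (p - 1)) * f s ^ p with hG
  set w : ℝ → ℝ≥0∞ := fun t => ENNReal.ofReal (W t ^ p * M t ^ (p - 1)) with hw
  have hGm : Measurable G := by fun_prop
  have hwm : Measurable w := by fun_prop
  set T : Set (ℝ × ℝ) := {x | x.1 ^ κ < x.2} with hT
  have hTm : MeasurableSet T := measurableSet_lt (by fun_prop) (by fun_prop)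
  have hpt : ∀ t ∈ Ioo (0 : ℝ) 1,
      (ENNReal.ofReal (W t) * ∫⁻ s in Ioo (t ^ κ) 1, ENNReal.ofReal (k s) * f s) ^ p ≤
        ∫⁻ s in Ioo (0 : ℝ) 1, T.indicator (fun x => w x.1 * G x.2) (t, s) := by
    intro t ht
    have htκ : 0 < t ^ κ := Real.rpow_pos_of_pos ht.1 κ
    have hsub : Ioo (t ^ κ) 1 ⊆ Ioo 0 1 := Ioo_subset_Ioo_left htκ.le
    have h1 := lintegral_mul_rpow_le (μ := volume.restrict (Ioo (t ^ κ) 1)) hp hk hρ hf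
      ((ae_restrict_iff' measurableSet_Ioo).2 (.of_forall fun s hs => hk0 s (hsub hs)))
      ((ae_restrict_iff' measurableSet_Ioo).2 (.of_forall fun s hs => hρ0 s (hsub hs)))
    have h2 : (∫⁻ s in Ioo (t ^ κ) 1, ENNReal.ofReal (ρ s)) ^ (p - 1) ≤
        ENNReal.ofReal (M t ^ (p - 1)) := by
      rw [← ENNReal.ofReal_rpow_of_pos (hM0 t ht)]
      exact ENNReal.rpow_le_rpow (hρM t ht) (by linarith)
    have h3 : ∫⁻ s in Ioo (0 : ℝ) 1, T.indicator (fun x => w x.1 * G x.2) (t, s) =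
        w t * ∫⁻ s in Ioo (t ^ κ) 1, G s := by
      rw [← lintegral_const_mul _ hGm, ← lintegral_indicator measurableSet_Ioo,
        ← lintegral_indicator measurableSet_Ioo]
      congr 1
      ext s
      by_cases h : s ∈ Ioo (t ^ κ) 1
      · rw [indicator_of_mem h, indicator_of_mem (hsub h),
          indicator_of_mem (show (t, s) ∈ T from h.1)]
      · rw [indicator_of_notMem h]
        by_cases h' : s ∈ Ioo (0 : ℝ) 1
        · rw [indicator_of_mem h', indicator_of_notMem]
          exact fun hmem => h ⟨hmem, h'.2⟩
        · rw [indicator_of_notMem h']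
    rw [h3, ENNReal.mul_rpow_of_nonneg _ _ hp0.le, ENNReal.ofReal_rpow_of_pos (hW0 t ht), hw]
    dsimp only
    rw [ENNReal.ofReal_mul (Real.rpow_nonneg (hW0 t ht).le p), mul_assoc]
    gcongr
    exact h1.trans (mul_le_mul_left h2 _)
  have hsw : ∀ s ∈ Ioo (0 : ℝ) 1,
      ∫⁻ t in Ioo (0 : ℝ) 1, T.indicator (fun x => w x.1 * G x.2) (t, s) ≤
        ENNReal.ofReal K * f s ^ p := by
    intro s hs
    have hks := hk0 s hs
    have hρs := hρ0 s hs
    calc ∫⁻ t in Ioo (0 : ℝ) 1, T.indicator (fun x => w x.1 * G x.2) (t, s)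
        ≤ ∫⁻ t in Ioo 0 (s ^ κ⁻¹), w t * G s := by
          rw [← lintegral_indicator measurableSet_Ioo, ← lintegral_indicator measurableSet_Ioo]
          refine lintegral_mono fun t => ?_
          by_cases h' : t ∈ Ioo (0 : ℝ) 1
          · rw [indicator_of_mem h']
            by_cases h : (t, s) ∈ T
            · have : t ∈ Ioo 0 (s ^ κ⁻¹) :=
                ⟨h'.1, (Real.lt_rpow_inv_iff_of_pos h'.1.le hs.1.le hκ).2 h⟩
              rw [indicator_of_mem h, indicator_of_mem this]
            · rw [indicator_of_notMem h]
              exact zero_le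
          · rw [indicator_of_notMem h']
            exact zero_le
      _ = (∫⁻ t in Ioo 0 (s ^ κ⁻¹), w t) * G s := lintegral_mul_const _ hwm
      _ ≤ ENNReal.ofReal (K * (ρ s ^ (p - 1) / k s ^ p)) * G s := by
          gcongr
          exact hWM s hs
      _ = ENNReal.ofReal K * f s ^ p := by
          rw [hG]
          dsimp only
          rw [← mul_assoc, ← ENNReal.ofReal_mul (by positivity)]
          congr 2
          field_simp
  calc _ ≤ ∫⁻ t in Ioo (0 : ℝ) 1, ∫⁻ s in Ioo (0 : ℝ) 1,
          T.indicator (fun x => w x.1 * G x.2) (t, s) :=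
        setLIntegral_mono' measurableSet_Ioo hpt
    _ = ∫⁻ s in Ioo (0 : ℝ) 1, ∫⁻ t in Ioo (0 : ℝ) 1,
          T.indicator (fun x => w x.1 * G x.2) (t, s) := by
        refine lintegral_lintegral_swap ?_
        exact (Measurable.indicator (by fun_prop) hTm).aemeasurable
    _ ≤ ∫⁻ s in Ioo (0 : ℝ) 1, ENNReal.ofReal K * f s ^ p :=
        setLIntegral_mono' measurableSet_Ioo hsw
    _ = _ := lintegral_const_mul _ (by fun_prop)

theorem rpow_one_div_le_of_le_mul {X Y : ℝ≥0∞} {K p : ℝ} (hp : 0 < p) (hK : 0 < K)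
    (h : X ≤ ENNReal.ofReal K * Y) :
    X ^ (1 / p) ≤ ENNReal.ofReal (K ^ (1 / p)) * Y ^ (1 / p) := by
  rw [← ENNReal.ofReal_rpow_of_pos hK, ← ENNReal.mul_rpow_of_nonneg _ _ (by positivity)]
  exact ENNReal.rpow_le_rpow h (by positivity)

/-- Hardy's inequality with power weights. -/
theorem lintegral_hardy_rpow_weight_le {a p κ : ℝ} (hp : 1 ≤ p) (hap : a * p < 1)
    (hκ : 0 < κ) : ∃ K : ℝ, 0 < K ∧ ∀ f : ℝ → ℝ≥0∞, Measurable f →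
      ∫⁻ t in Ioo (0 : ℝ) 1, (ENNReal.ofReal (t ^ ((κ * (1 - a * p) - 1) / p)) *
        ∫⁻ s in Ioo (t ^ κ) 1, ENNReal.ofReal (s ^ (a - 1)) * f s) ^ p ≤
      ENNReal.ofReal K * ∫⁻ s in Ioo (0 : ℝ) 1, f s ^ p := by
  have hp0 : 0 < p := by linarith
  obtain ⟨δ, hδ⟩ : ∃ δ, δ = (1 - a * p) / p := ⟨_, rfl⟩
  have hδ0 : 0 < δ := hδ ▸ div_pos (by linarith) hp0
  have hδp : δ * p = 1 - a * p := by rw [hδ]; field_simp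
  refine ⟨(1 / δ) ^ (p - 1) * (1 / (κ * δ)), by positivity, fun f hf => ?_⟩
  refine lintegral_hardy_rpow_le (ρ := fun s => s ^ (-1 - δ)) (M := fun t => (t ^ κ) ^ (-δ) / δ)
    hp hκ (by positivity) (by fun_prop) (by fun_prop) (by fun_prop) (by fun_prop) hf
    (fun s hs => Real.rpow_pos_of_pos hs.1 _) (fun s hs => Real.rpow_pos_of_pos hs.1 _)
    (fun s hs => Real.rpow_pos_of_pos hs.1 _) (fun s hs => ?_)
    (fun t ht => lintegral_Ioo_one_rpow_le (Real.rpow_pos_of_pos ht.1 _) hδ0) ?_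
  · have := hs.1
    positivity
  intro s hs
  have hs0 := hs.1
  have h1 : ∀ t ∈ Ioo 0 (s ^ κ⁻¹),
      ENNReal.ofReal ((t ^ ((κ * (1 - a * p) - 1) / p)) ^ p * ((t ^ κ) ^ (-δ) / δ) ^ (p - 1)) =
        ENNReal.ofReal ((1 / δ) ^ (p - 1)) * ENNReal.ofReal (t ^ (κ * δ - 1)) := by
    intro t ht
    have ht0 := ht.1
    rw [← ENNReal.ofReal_mul (by positivity)]
    congr 1
    rw [div_eq_mul_one_div _ δ, Real.mul_rpow (by positivity) (by positivity),
      ← Real.rpow_mul ht0.le, ← Real.rpow_mul ht0.le, ← Real.rpow_mul ht0.le, ← mul_assoc,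
      ← Real.rpow_add ht0, mul_comm]
    congr 2
    rw [div_mul_cancel₀ _ hp0.ne', ← hδp]
    ring
  rw [setLIntegral_congr_fun measurableSet_Ioo h1, lintegral_const_mul _ (by fun_prop)]
  refine (mul_le_mul_right (lintegral_Ioo_zero_rpow_le (by positivity)) _).trans_eq ?_
  rw [← ENNReal.ofReal_mul (by positivity), mul_assoc]
  congr 2
  rw [← Real.rpow_mul hs0.le, ← Real.rpow_mul hs0.le, ← Real.rpow_mul hs0.le,
    ← Real.rpow_sub hs0, inv_mul_cancel_left₀ hκ.ne',
    show (-1 - δ) * (p - 1) - (a - 1) * p = δ by linear_combination -hδp]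
  ring

/-- Hardy's inequality with a logarithmic weight, in the limiting case. -/
theorem lintegral_hardy_log_weight_le {p κ : ℝ} (hp : 1 < p) (hκ : 0 < κ) :
    ∃ K : ℝ, 0 < K ∧ ∀ f : ℝ → ℝ≥0∞, Measurable f →
      ∫⁻ t in Ioo (0 : ℝ) 1, (ENNReal.ofReal (t ^ (-1 / p) * (Real.log (Real.exp 1 / t))⁻¹) *
        ∫⁻ s in Ioo (t ^ κ) 1, ENNReal.ofReal (s ^ (1 / p - 1)) * f s) ^ p ≤
      ENNReal.ofReal K * ∫⁻ s in Ioo (0 : ℝ) 1, f s ^ p := by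
  have hp0 : 0 < p := by linarith
  have hp1 : 0 < p - 1 := by linarith
  have hlog : ∀ t : ℝ, 0 < t → Real.log (Real.exp 1 / t) = 1 - Real.log t := fun t ht => by
    rw [Real.log_div (Real.exp_ne_zero 1) ht.ne', Real.log_exp]
  have hL : ∀ t ∈ Ioo (0 : ℝ) 1, 0 < 1 - Real.log t := fun t ht => by
    have := Real.log_neg ht.1 ht.2
    linarith
  have hl : ∀ t ∈ Ioo (0 : ℝ) 1, 0 < 1 - κ⁻¹ * Real.log t := fun t ht => by
    have := mul_neg_of_pos_of_neg (inv_pos.2 hκ) (Real.log_neg ht.1 ht.2)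
    linarith
  refine ⟨(2 * κ) ^ (p - 1) * (2 / (p - 1)), by positivity, fun f hf => ?_⟩
  refine lintegral_hardy_rpow_le (ρ := fun s => s⁻¹ * (1 - κ⁻¹ * Real.log s) ^ (-1 / 2 : ℝ))
    (M := fun t => 2 * κ * (1 - Real.log t) ^ (1 / 2 : ℝ))
    hp.le hκ (by positivity) (by fun_prop) (by fun_prop) (by fun_prop) (by fun_prop) hf
    (fun s hs => Real.rpow_pos_of_pos hs.1 _) (fun s hs => ?_) (fun s hs => ?_) (fun s hs => ?_)
    ?_ ?_
  · exact mul_pos (inv_pos.2 hs.1) (Real.rpow_pos_of_pos (hl s hs) _)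
  · rw [hlog s hs.1]
    exact mul_pos (Real.rpow_pos_of_pos hs.1 _) (inv_pos.2 (hL s hs))
  · have := hL s hs
    positivity
  · intro t ht
    have htκ : 0 < t ^ κ := Real.rpow_pos_of_pos ht.1 κ
    have hLt := hL t ht
    have hsub : ∀ x ∈ Ioo (t ^ κ) 1, x ∈ Ioo (0 : ℝ) 1 := fun x hx => ⟨htκ.trans hx.1, hx.2⟩
    have h := lintegral_Ioo_deriv_le
      (F := fun s => -(2 * κ * (1 - κ⁻¹ * Real.log s) ^ (1 / 2 : ℝ)))
      (g := fun s => s⁻¹ * (1 - κ⁻¹ * Real.log s) ^ (-1 / 2 : ℝ)) (a := t ^ κ) (b := 1)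
      (A := -(2 * κ * (1 - Real.log t) ^ (1 / 2 : ℝ))) (B := 0) ?_ ?_ ?_
    · simpa using h
    · intro x hx
      have hx' := hsub x hx
      have hd := ((((Real.hasDerivAt_log hx'.1.ne').const_mul κ⁻¹).const_sub 1).rpow_const
        (p := (1 / 2 : ℝ)) (Or.inl (hl x hx').ne')).const_mul (2 * κ) |>.neg
      refine hd.congr_deriv ?_
      rw [show (1 / 2 - 1 : ℝ) = -1 / 2 by norm_num]
      field_simp
    · intro x hx
      have hx' := hsub x hx
      exact (mul_pos (inv_pos.2 hx'.1) (Real.rpow_pos_of_pos (hl x hx') _)).le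
    · intro x hx
      have hx' := hsub x hx
      have hlx := hl x hx'
      refine ⟨neg_le_neg ?_, neg_nonpos.2 (by positivity)⟩
      have : Real.log t ≤ κ⁻¹ * Real.log x := by
        rw [le_inv_mul_iff₀ hκ, ← Real.log_rpow ht.1]
        exact Real.log_le_log htκ hx.1.le
      gcongr
  · intro s hs
    have hs0 := hs.1
    have hls := hl s hs
    have hsκ : s ^ κ⁻¹ < 1 := Real.rpow_lt_one hs0.le hs.2 (inv_pos.2 hκ)
    have hsub : ∀ t ∈ Ioo 0 (s ^ κ⁻¹), t ∈ Ioo (0 : ℝ) 1 := fun t ht => ⟨ht.1, ht.2.trans hsκ⟩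
    have h1 : ∀ t ∈ Ioo 0 (s ^ κ⁻¹),
        ENNReal.ofReal ((t ^ (-1 / p) * (Real.log (Real.exp 1 / t))⁻¹) ^ p *
          (2 * κ * (1 - Real.log t) ^ (1 / 2 : ℝ)) ^ (p - 1)) =
        ENNReal.ofReal ((2 * κ) ^ (p - 1)) *
          ENNReal.ofReal (t⁻¹ * (1 - Real.log t) ^ (-((p - 1) / 2) - 1)) := by
      intro t ht
      have ht0 := ht.1
      have hLt := hL t (hsub t ht)
      rw [← ENNReal.ofReal_mul (by positivity), hlog t ht0]
      congr 1
      rw [Real.mul_rpow (by positivity) (by positivity),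
        Real.mul_rpow (by positivity) (by positivity), ← Real.rpow_mul ht0.le,
        ← Real.rpow_mul hLt.le, div_mul_cancel₀ _ hp0.ne', Real.rpow_neg_one,
        ← Real.rpow_neg_one (1 - Real.log t), ← Real.rpow_mul hLt.le,
        show -((p - 1) / 2) - 1 = -1 * p + 1 / 2 * (p - 1) by ring, Real.rpow_add hLt]
      ring
    rw [setLIntegral_congr_fun measurableSet_Ioo h1, lintegral_const_mul _ (by fun_prop)]
    have h2 := lintegral_Ioo_deriv_le
      (F := fun t => 2 / (p - 1) * (1 - Real.log t) ^ (-((p - 1) / 2)))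
      (g := fun t => t⁻¹ * (1 - Real.log t) ^ (-((p - 1) / 2) - 1)) (a := 0) (b := s ^ κ⁻¹)
      (A := 0) (B := 2 / (p - 1) * (1 - κ⁻¹ * Real.log s) ^ (-((p - 1) / 2))) ?_ ?_ ?_
    · refine (mul_le_mul_right h2 _).trans_eq ?_
      rw [← ENNReal.ofReal_mul (by positivity), sub_zero]
      congr 1
      rw [Real.mul_rpow (inv_nonneg.2 hs0.le) (Real.rpow_nonneg hls.le _),
        ← Real.rpow_mul hls.le,
        ← Real.rpow_mul hs0.le, ← Real.rpow_neg_one s, ← Real.rpow_mul hs0.le,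
        show (1 / p - 1) * p = -1 * (p - 1) by field_simp; ring,
        show -1 / 2 * (p - 1) = -((p - 1) / 2) by ring]
      field_simp
    · intro x hx
      have hx' := hsub x hx
      have hd := (((Real.hasDerivAt_log hx'.1.ne').const_sub 1).rpow_const
        (p := -((p - 1) / 2)) (Or.inl (hL x hx').ne')).const_mul (2 / (p - 1))
      refine hd.congr_deriv ?_
      field_simp
    · intro x hx
      have hx' := hsub x hx
      exact (mul_pos (inv_pos.2 hx'.1) (Real.rpow_pos_of_pos (hL x hx') _)).le
    · intro x hx
      have hLx := hL x (hsub x hx)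
      refine ⟨by positivity, ?_⟩
      have : Real.log x ≤ κ⁻¹ * Real.log s := by
        rw [← Real.log_rpow hs0]
        exact Real.log_le_log hx.1 hx.2.le
      exact mul_le_mul_of_nonneg_left
        (Real.rpow_le_rpow_of_nonpos hls (by linarith) (by linarith)) (by positivity)

/-- Hölder's inequality for the kernel `s ^ (a - 1)` above the critical exponent. -/
theorem lintegral_rpow_mul_le {a p : ℝ} (hp : 1 < p) (hap : 1 < a * p) :
    ∃ C : ℝ, 0 < C ∧ ∀ f : ℝ → ℝ≥0∞, Measurable f →
      ∫⁻ s in Ioo (0 : ℝ) 1, ENNReal.ofReal (s ^ (a - 1)) * f s ≤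
        ENNReal.ofReal C * (∫⁻ s in Ioo (0 : ℝ) 1, f s ^ p) ^ (1 / p) := by
  have hp0 : 0 < p := by linarith
  have hp1 : 0 < p - 1 := by linarith
  obtain ⟨η, hη⟩ : ∃ η, η = (a * p - 1) / (p - 1) := ⟨_, rfl⟩
  have hη0 : 0 < η := hη ▸ div_pos (by linarith) hp1
  have hηp : η * (p - 1) = a * p - 1 := by rw [hη]; field_simp
  refine ⟨((1 / η) ^ (p - 1)) ^ (1 / p), by positivity, fun f hf => ?_⟩
  have h0 : ∀ e : ℝ, ∀ᵐ s ∂volume.restrict (Ioo (0 : ℝ) 1), 0 < s ^ e := fun e =>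
    (ae_restrict_iff' measurableSet_Ioo).2 (.of_forall fun s hs => Real.rpow_pos_of_pos hs.1 _)
  have h := lintegral_mul_rpow_le (k := fun s => s ^ (a - 1)) (ρ := fun s => s ^ (η - 1))
    hp.le (by fun_prop) (by fun_prop) hf (h0 _) (h0 _)
  have h1 : ∀ s ∈ Ioo (0 : ℝ) 1,
      ENNReal.ofReal ((s ^ (a - 1)) ^ p / (s ^ (η - 1)) ^ (p - 1)) * f s ^ p = f s ^ p := by
    intro s hs
    rw [← Real.rpow_mul hs.1.le, ← Real.rpow_mul hs.1.le, ← Real.rpow_sub hs.1,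
      show (a - 1) * p - (η - 1) * (p - 1) = 0 by linear_combination -hηp]
    simp
  rw [setLIntegral_congr_fun measurableSet_Ioo h1] at h
  have h2 : (∫⁻ s in Ioo (0 : ℝ) 1, ENNReal.ofReal (s ^ (η - 1))) ^ (p - 1) ≤
      ENNReal.ofReal ((1 / η) ^ (p - 1)) := by
    rw [← ENNReal.ofReal_rpow_of_pos (by positivity)]
    refine ENNReal.rpow_le_rpow ?_ hp1.le
    simpa using lintegral_Ioo_zero_rpow_le (b := 1) hη0
  have h3 := rpow_one_div_le_of_le_mul hp0 (by positivity) (h.trans (mul_le_mul_left h2 _))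
  rwa [← ENNReal.rpow_mul, mul_one_div_cancel hp0.ne', ENNReal.rpow_one] at h3

theorem S1_le_lintegral_Ioo {n m : ℕ} {d t : ℝ} {f : ℝ → ℝ≥0∞} (ht : 0 < t) :
    S1 n m d f t ≤ ∫⁻ s in Ioo (0 : ℝ) 1, ENNReal.ofReal (s ^ ((m : ℝ) / n - 1)) * f s :=
  lintegral_mono_set (Ioo_subset_Ioo_left (Real.rpow_nonneg ht.le _))

/-- **Boundedness of the Hardy-type operator `S₁` between Lebesgue/Lorentz spaces:**
(a) `S₁ : L^p → L^{dp/(n-mp),p}` for admissible `p < n/m`;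
(b) `S₁ : L^{n/m} → L^{∞,n/m;-1}`;
(c) `S₁ : L^p → L^∞` for `p ∈ (n/m, ∞]`. -/
theorem S1_boundedness (n m : ℕ) (hn : 2 ≤ n) (hm : 1 ≤ m) (hmn : m < n) :
    -- (a)
    (∀ d p : ℝ,
      (((n : ℝ) - m ≤ d ∧ d ≤ n ∧ 1 ≤ p) ∨
        (0 < d ∧ d < (n : ℝ) - m ∧ ((n : ℝ) - d) / m < p)) →
      p < (n : ℝ) / m →
      ∃ C : ℝ, 0 < C ∧ ∀ f : ℝ → ℝ≥0∞, Measurable f →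
        (∫⁻ t in Set.Ioo (0 : ℝ) 1,
            (ENNReal.ofReal (t ^ (((n : ℝ) - m * p) / (d * p) - 1 / p)) *
              S1 n m d f t) ^ p) ^ (1 / p) ≤
          ENNReal.ofReal C * (∫⁻ s in Set.Ioo (0 : ℝ) 1, f s ^ p) ^ (1 / p)) ∧
    -- (b)
    (∀ d : ℝ, 0 < d → d ≤ n →
      ∃ C : ℝ, 0 < C ∧ ∀ f : ℝ → ℝ≥0∞, Measurable f →
        (∫⁻ t in Set.Ioo (0 : ℝ) 1,
            (ENNReal.ofReal (t ^ (-(m : ℝ) / n) * (Real.log (Real.exp 1 / t))⁻¹) *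
              S1 n m d f t) ^ ((n : ℝ) / m)) ^ ((m : ℝ) / n) ≤
          ENNReal.ofReal C *
            (∫⁻ s in Set.Ioo (0 : ℝ) 1, f s ^ ((n : ℝ) / m)) ^ ((m : ℝ) / n)) ∧
    -- (c), finite p
    (∀ d p : ℝ, 0 < d → d ≤ n → (n : ℝ) / m < p →
      ∃ C : ℝ, 0 < C ∧ ∀ f : ℝ → ℝ≥0∞, Measurable f → ∀ t ∈ Set.Ioo (0 : ℝ) 1,
        S1 n m d f t ≤ ENNReal.ofReal C * (∫⁻ s in Set.Ioo (0 : ℝ) 1, f s ^ p) ^ (1 / p)) ∧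
    -- (c), p = ∞
    (∀ d : ℝ, 0 < d → d ≤ n →
      ∃ C : ℝ, 0 < C ∧ ∀ f : ℝ → ℝ≥0∞, Measurable f → ∀ t ∈ Set.Ioo (0 : ℝ) 1,
        S1 n m d f t ≤ ENNReal.ofReal C * essSup f vol01) := by
  have hn0 : (0 : ℝ) < n := by positivity
  have hm0 : (0 : ℝ) < m := by exact_mod_cast hm
  have hmn' : (m : ℝ) < n := by exact_mod_cast hmn
  have hnm1 : 1 < (n : ℝ) / m := by rwa [one_lt_div hm0]
  refine ⟨?_, ?_, ?_, ?_⟩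
  · intro d p hdp hp
    obtain ⟨hd, hp1⟩ : 0 < d ∧ 1 ≤ p := by
      rcases hdp with ⟨h1, -, h3⟩ | ⟨h1, h2, h3⟩
      · exact ⟨by linarith, h3⟩
      · refine ⟨h1, le_trans ?_ h3.le⟩
        rw [one_le_div hm0]
        linarith
    have hp0 : 0 < p := by linarith
    have hap : (m : ℝ) / n * p < 1 := by
      rw [lt_div_iff₀ hm0] at hp
      rw [div_mul_eq_mul_div, div_lt_one hn0]
      linarith
    obtain ⟨K, hK, h⟩ := lintegral_hardy_rpow_weight_le hp1 hap (div_pos hn0 hd)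
    refine ⟨K ^ (1 / p), by positivity, fun f hf => rpow_one_div_le_of_le_mul hp0 hK ?_⟩
    have he : ((n : ℝ) - m * p) / (d * p) - 1 / p = ((n : ℝ) / d * (1 - m / n * p) - 1) / p := by
      field_simp
    rw [he]
    exact h f hf
  · intro d hd _
    obtain ⟨K, hK, h⟩ := lintegral_hardy_log_weight_le hnm1 (div_pos hn0 hd)
    refine ⟨K ^ ((m : ℝ) / n), by positivity, fun f hf => ?_⟩
    have := rpow_one_div_le_of_le_mul (zero_lt_one.trans hnm1) hK (h f hf)
    rw [one_div_div, show -1 / ((n : ℝ) / m) = -(m : ℝ) / n by field_simp] at this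
    exact this
  · intro d p _ _ hp
    have hap : 1 < (m : ℝ) / n * p := by
      rw [div_lt_iff₀ hm0] at hp
      rw [div_mul_eq_mul_div, one_lt_div hn0]
      linarith
    obtain ⟨C, hC, h⟩ := lintegral_rpow_mul_le (hnm1.trans hp) hap
    exact ⟨C, hC, fun f hf t ht => (S1_le_lintegral_Ioo ht.1).trans (h f hf)⟩
  · intro d _ _
    have ha : (0 : ℝ) < (m : ℝ) / n := by positivity
    refine ⟨1 / ((m : ℝ) / n), by positivity, fun f _ t ht => (S1_le_lintegral_Ioo ht.1).trans ?_⟩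
    calc ∫⁻ s in Ioo (0 : ℝ) 1, ENNReal.ofReal (s ^ ((m : ℝ) / n - 1)) * f s
        ≤ ∫⁻ s in Ioo (0 : ℝ) 1, ENNReal.ofReal (s ^ ((m : ℝ) / n - 1)) * essSup f vol01 := by
          refine lintegral_mono_ae ?_
          filter_upwards [ENNReal.ae_le_essSup (μ := volume.restrict (Ioo (0 : ℝ) 1)) f] with s hs
          exact mul_le_mul_right hs _
      _ = (∫⁻ s in Ioo (0 : ℝ) 1, ENNReal.ofReal (s ^ ((m : ℝ) / n - 1))) * essSup f vol01 :=
          lintegral_mul_const _ (by fun_prop)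
      _ ≤ _ := by
          gcongr
          simpa using lintegral_Ioo_zero_rpow_le (b := 1) ha
end
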